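/- arXiv:2102.10872 — 11 statements merged into one kernel-verified Lean document; each statement's English description precedes it below -/
import Mathlib

section
/- Let S be any semigroup and let ℕ denote the semigroup of positive integers under addition. Then the direct product ℕ × S is completely separable if and only if S is completely separable. -/
/-- `s` can be separated from `Y` in `S`: there is a homomorphism to a finite
semigroup mapping `s` outside the image of `Y`. -/
def Separates {S : Type*} [Semigroup S] (s : S) (Y : Set S) : Prop :=
  ∃ (P : Type) (_ : Semigroup P) (_ : Finite P) (φ : S →ₙ* P), φ s ∉ φ '' Y

/-- Complete separability. -/
def IsCS (S : Type*) [Semigroup S] : Prop :=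
  ∀ (s : S) (Y : Set S), s ∉ Y → Separates s Y

/-- Strong subsemigroup separability. -/
def IsSSS (S : Type*) [Semigroup S] : Prop :=
  ∀ (s : S) (Y : Subsemigroup S), s ∉ Y → Separates s (Y : Set S)

/-- Weak subsemigroup separability. -/
def IsWSS (S : Type*) [Semigroup S] : Prop :=
  ∀ (s : S) (X : Finset S), s ∉ Subsemigroup.closure (X : Set S) →
    Separates s (Subsemigroup.closure (X : Set S) : Set S)

/-- Monogenic subsemigroup separability. -/
def IsMSS (S : Type*) [Semigroup S] : Prop :=
  ∀ (s x : S), s ∉ Subsemigroup.closure {x} →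
    Separates s (Subsemigroup.closure {x} : Set S)

/-- Residual finiteness. -/
def ResiduallyFinite (S : Type*) [Semigroup S] : Prop :=
  ∀ s t : S, s ≠ t → ∃ (P : Type) (_ : Semigroup P) (_ : Finite P) (φ : S →ₙ* P), φ s ≠ φ t

/-- A congruence with finitely many classes, one of which is `{s}`, separates `s` from every
set that does not contain it. -/
theorem Separates.of_con {S : Type*} [Semigroup S] (c : Con S) [Finite c.Quotient] {s : S}
    (hc : ∀ b, c b s → b = s) {Y : Set S} (hs : s ∉ Y) : Separates s Y := by
  let e : c.Quotient ≃* Shrink.{0} c.Quotient := Shrink.mulEquiv.symm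
  refine ⟨Shrink.{0} c.Quotient, inferInstance, .of_equiv _ e.toEquiv,
    ⟨fun a => e (a : c.Quotient), fun a b => by simp⟩, ?_⟩
  rintro ⟨b, hb, hbs⟩
  have h : (b : c.Quotient) = s := e.injective hbs
  exact hs (hc b (c.eq.1 h) ▸ hb)

/-- A relation containing the kernel of a map to a finite type has finitely many classes. -/
theorem Con.finite_quotient_of_map {S T : Type*} [Mul S] [Finite T] (c : Con S) (f : S → T)
    (h : ∀ a b, f a = f b → c a b) : Finite c.Quotient := by
  refine Finite.of_injective (fun q : c.Quotient => f (Quotient.out q)) fun p q hpq => ?_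
  have := h _ _ hpq
  rw [← Quotient.out_eq p, ← Quotient.out_eq q]
  exact Quotient.sound this

/-- The syntactic congruence of the singleton `{s}`. -/
def syntacticCon {S : Type*} [Semigroup S] (s : S) : Con S where
  r a b := ∀ x y : WithOne S, x * a * y = s ↔ x * b * y = s
  iseqv := ⟨fun _ _ _ => Iff.rfl, fun h x y => (h x y).symm,
    fun h k x y => (h x y).trans (k x y)⟩
  mul' {a b c d} h k x y := by
    have h' := h x (c * y)
    have k' := k (x * b) y
    simp only [WithOne.coe_mul, mul_assoc] at h' k' ⊢
    exact h'.trans k'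

theorem eq_of_syntacticCon {S : Type*} [Semigroup S] {s b : S} (h : syntacticCon s b s) :
    b = s := by
  have := (h 1 1).2 (by simp)
  simpa using this

/-- The direct product of completely separable semigroups is completely separable. -/
theorem IsCS.prod {S T : Type*} [Semigroup S] [Semigroup T] (hS : IsCS S) (hT : IsCS T) :
    IsCS (S × T) := by
  rintro ⟨s, t⟩ Y hY
  obtain ⟨P, _, _, φ, hφ⟩ := hS s {s}ᶜ (by simp)
  obtain ⟨Q, _, _, ψ, hψ⟩ := hT t {t}ᶜ (by simp)
  refine ⟨P × Q, inferInstance, inferInstance, φ.prodMap ψ, ?_⟩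
  rintro ⟨⟨a, b⟩, hab, h⟩
  have h₁ : φ a = φ s := congrArg Prod.fst h
  have h₂ : ψ b = ψ t := congrArg Prod.snd h
  have ha : a = s := by
    by_contra hne
    exact hφ ⟨a, hne, h₁⟩
  have hb : b = t := by
    by_contra hne
    exact hψ ⟨b, hne, h₂⟩
  exact hY (ha ▸ hb ▸ hab)

/-- The congruence on the positive integers that identifies all integers above `n`. -/
def truncationCon (n : ℕ) : Con (Multiplicative ℕ+) where
  r a b := min (a.toAdd : ℕ) (n + 1) = min (b.toAdd : ℕ) (n + 1)
  iseqv := ⟨fun _ => rfl, Eq.symm, Eq.trans⟩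
  mul' {a b c d} h k := by
    simp only [toAdd_mul, PNat.add_coe]
    omega

theorem isCS_multiplicative_pnat : IsCS (Multiplicative ℕ+) := by
  intro s Y hs
  have : Finite (truncationCon (s.toAdd : ℕ)).Quotient :=
    Con.finite_quotient_of_map _
      (fun a => (⟨min (a.toAdd : ℕ) (s.toAdd + 1), by omega⟩ : Fin ((s.toAdd : ℕ) + 2)))
      fun a b h => congrArg Fin.val h
  refine Separates.of_con (truncationCon (s.toAdd : ℕ)) (fun b hb => ?_) hs
  have h : min (b.toAdd : ℕ) (s.toAdd + 1) = min (s.toAdd : ℕ) (s.toAdd + 1) := hb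
  apply Multiplicative.toAdd.injective
  apply PNat.coe_injective
  omega

theorem IsCS.of_pnat_prod {S : Type*} [Semigroup S] (h : IsCS (Multiplicative ℕ+ × S)) :
    IsCS S := by
  intro s Y hs
  obtain ⟨P, _, _, φ, hφ⟩ := h (.ofAdd 3, s) {(.ofAdd 3, s)}ᶜ (by simp)
  have key : ∀ u v : Multiplicative ℕ+ × S, φ u = φ v →
      u = (.ofAdd 3, s) → v = (.ofAdd 3, s) := by
    intro u v huv hu
    by_contra hne
    exact hφ ⟨v, hne, by rw [← huv, hu]⟩
  have imp : ∀ a b : S, φ (.ofAdd 1, a) = φ (.ofAdd 1, b) → φ (.ofAdd 3, a) = φ (.ofAdd 3, b) →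
      ∀ x y : WithOne S, x * a * y = s → x * b * y = s := by
    intro a b h₁ h₃ x y
    have left (z : S) : z * a = s → z * b = s := fun hz =>
      congrArg Prod.snd (key ((.ofAdd 2, z) * (.ofAdd 1, a)) ((.ofAdd 2, z) * (.ofAdd 1, b))
        (by rw [map_mul, map_mul, h₁]) (Prod.ext rfl hz))
    have right (z : S) : a * z = s → b * z = s := fun hz =>
      congrArg Prod.snd (key ((.ofAdd 1, a) * (.ofAdd 2, z)) ((.ofAdd 1, b) * (.ofAdd 2, z))
        (by rw [map_mul, map_mul, h₁]) (Prod.ext rfl hz))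
    have both (z w : S) : z * a * w = s → z * b * w = s := fun hz =>
      congrArg Prod.snd (key ((.ofAdd 1, z) * (.ofAdd 1, a) * (.ofAdd 1, w))
        ((.ofAdd 1, z) * (.ofAdd 1, b) * (.ofAdd 1, w))
        (by simp only [map_mul, h₁]) (Prod.ext rfl hz))
    have none : a = s → b = s := fun hz =>
      congrArg Prod.snd (key (.ofAdd 3, a) (.ofAdd 3, b) h₃ (Prod.ext rfl hz))
    induction x using WithOne.cases_on <;> induction y using WithOne.cases_on <;>
      simp only [one_mul, mul_one, ← WithOne.coe_mul, WithOne.coe_inj]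
    exacts [none, right, left, fun w z => both z w]
  have : Finite (syntacticCon s).Quotient :=
    Con.finite_quotient_of_map _
      (fun a => (φ (.ofAdd 1, a), φ (.ofAdd 3, a))) fun a b hab x y => by
        obtain ⟨h₁, h₃⟩ := Prod.mk.inj hab
        exact ⟨imp a b h₁ h₃ x y, imp b a h₁.symm h₃.symm x y⟩
  exact Separates.of_con (syntacticCon s) (fun b => eq_of_syntacticCon) hs

/-- `ℕ × S` is completely separable iff `S` is completely separable, where `ℕ` is
the semigroup of positive integers under addition. -/
theorem stmt_0 (S : Type*) [Semigroup S] :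
    IsCS (Multiplicative ℕ+ × S) ↔ IsCS S :=
  ⟨IsCS.of_pnat_prod, isCS_multiplicative_pnat.prod⟩
end

section
/- Let S be a strongly subsemigroup separable semigroup, let n be a positive integer, and let V ⊆ S be a subset such that V^{n+1} ⊆ V (where V^k denotes the set of all products of k elements of V). Then for every s ∈ S \ V there exist a finite semigroup P and a semigroup homomorphism φ : S → P such that φ(s) ∉ φ(V). -/
open Pointwise in
/-- `setPow V n` is the set `V^(n+1)` of all products of `n+1` elements of `V`. -/
def setPow {S : Type*} [Semigroup S] (V : Set S) : ℕ → Set S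
  | 0 => V
  | n + 1 => setPow V n * V

open Pointwise in
theorem setPow_mul_setPow {S : Type*} [Semigroup S] (V : Set S) (i j : ℕ) :
    setPow V i * setPow V j = setPow V (i + j + 1) := by
  induction j with
  | zero => rfl
  | succ j ih =>
    change setPow V i * (setPow V j * V) = setPow V (i + j + 1) * V
    rw [← mul_assoc, ih]

open Pointwise in
theorem setPow_add_subset {S : Type*} [Semigroup S] {V : Set S} {n : ℕ}
    (hV : setPow V n ⊆ V) (a : ℕ) : setPow V (a + n) ⊆ setPow V a := by
  induction a with
  | zero => simpa [setPow] using hV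
  | succ a ih =>
    rw [Nat.add_right_comm]
    exact Set.mul_subset_mul_right ih

theorem setPow_mul_subset {S : Type*} [Semigroup S] {V : Set S} {n : ℕ}
    (hV : setPow V n ⊆ V) (q : ℕ) : setPow V (n * q) ⊆ V := by
  induction q with
  | zero => exact subset_rfl
  | succ q ih => exact (setPow_add_subset hV (n * q)).trans ih

/-- The subsemigroup of `S × ℤ/n` generated by the pairs `(v, 1)` with `v ∈ V`: it records
which elements are products of `k` elements of `V`, together with the residue of `k`. -/
def gradedClosure {S : Type*} [Semigroup S] (V : Set S) (n : ℕ) :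
    Subsemigroup (S × Multiplicative (ZMod n)) :=
  Subsemigroup.closure ((fun v => (v, Multiplicative.ofAdd 1)) '' V)

theorem gradedClosure_of_mem {S : Type*} [Semigroup S] {V : Set S} (n : ℕ) {v : S} (hv : v ∈ V) :
    (v, Multiplicative.ofAdd 1) ∈ gradedClosure V n :=
  Subsemigroup.subset_closure ⟨v, hv, rfl⟩

theorem mem_of_gradedClosure {S : Type*} [Semigroup S] {V : Set S} {n : ℕ}
    (hV : setPow V n ⊆ V) {x : S}
    (hx : (x, Multiplicative.ofAdd 1) ∈ gradedClosure V n) : x ∈ V := by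
  have key : ∀ p ∈ gradedClosure V n, ∃ k : ℕ, p.1 ∈ setPow V k ∧
      p.2 = Multiplicative.ofAdd ((k : ZMod n) + 1) := by
    intro p hp
    induction hp using Subsemigroup.closure_induction with
    | mem p hp =>
      obtain ⟨v, hv, rfl⟩ := hp
      exact ⟨0, hv, by simp⟩
    | mul p q _ _ hp hq =>
      obtain ⟨i, hi, hi'⟩ := hp
      obtain ⟨j, hj, hj'⟩ := hq
      refine ⟨i + j + 1, ?_, ?_⟩
      · rw [← setPow_mul_setPow]
        exact Set.mul_mem_mul hi hj
      · rw [Prod.snd_mul, hi', hj', ← ofAdd_add]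
        congr 1
        push_cast
        ring
  obtain ⟨k, hk, hk'⟩ := key _ hx
  have h0 : (k : ZMod n) = 0 := by
    have := Multiplicative.ofAdd.injective hk'
    simpa using this
  obtain ⟨q, rfl⟩ := (ZMod.natCast_eq_zero_iff k n).1 h0
  exact setPow_mul_subset hV q hk

theorem exists_gradedClosure {S : Type*} [Semigroup S] {V : Set S} {n : ℕ} {A : Set S}
    (hA : ∀ a ∈ A, ∃ c, (a, c) ∈ gradedClosure V n) {x : S}
    (hx : x ∈ Subsemigroup.closure A) : ∃ c, (x, c) ∈ gradedClosure V n := by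
  induction hx using Subsemigroup.closure_induction with
  | mem a ha => exact hA a ha
  | mul x y _ _ hx hy =>
    obtain ⟨c, hc⟩ := hx
    obtain ⟨d, hd⟩ := hy
    exact ⟨c * d, mul_mem hc hd⟩

theorem inv_mem_of_isIdempotentElem {S G : Type*} [Semigroup S] [Group G] [Finite G]
    {B : Subsemigroup (S × G)} {e : S} (he : e * e = e) {c : G} (hc : (e, c) ∈ B) :
    (e, c⁻¹) ∈ B := by
  have hpow : ∀ k : ℕ, (e, c ^ (k + 1)) ∈ B := by
    intro k
    induction k with
    | zero => simpa using hc
    | succ k ih =>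
      have := mul_mem ih hc
      rwa [Prod.mk_mul_mk, he, ← pow_succ] at this
  have hpos := orderOf_pos c
  have h : c⁻¹ = c ^ (2 * orderOf c - 2 + 1) := by
    rw [inv_eq_iff_mul_eq_one, ← pow_succ',
      show 2 * orderOf c - 2 + 1 + 1 = orderOf c * 2 by omega, pow_mul, pow_orderOf_eq_one, one_pow]
  rw [h]
  exact hpow _

/-- Every element of the subsemigroup generated by `A` has a left factor in `A`. -/
theorem exists_left_factor {S : Type*} [Semigroup S] {A : Set S} {x : S}
    (hx : x ∈ Subsemigroup.closure A) :
    ∃ a ∈ A, x = a ∨ ∃ z ∈ Subsemigroup.closure A, x = a * z := by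
  induction hx using Subsemigroup.closure_induction with
  | mem a ha => exact ⟨a, ha, Or.inl rfl⟩
  | mul x y _ hy hx _ =>
    obtain ⟨a, ha, rfl | ⟨z, hz, rfl⟩⟩ := hx
    · exact ⟨x, ha, Or.inr ⟨y, hy, rfl⟩⟩
    · exact ⟨a, ha, Or.inr ⟨z * y, mul_mem hz hy, mul_assoc _ _ _⟩⟩

theorem exists_idempotent_of_finite_semigroup (P : Type*) [Semigroup P] [Finite P] [Nonempty P] :
    ∃ p : P, p * p = p := by
  let _ : TopologicalSpace P := ⊥
  have : DiscreteTopology P := ⟨rfl⟩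
  exact exists_idempotent_of_compact_t2_of_continuous_mul_left fun _ => continuous_of_discreteTopology

theorem not_separates_iff {S : Type*} [Semigroup S] {s : S} {Y : Set S} :
    ¬ Separates s Y ↔ ∀ (P : Type) [Semigroup P] [Finite P] (φ : S →ₙ* P), ∃ y ∈ Y, φ y = φ s := by
  unfold Separates
  push Not
  exact Iff.rfl

/-- Subsemigroups of a strongly subsemigroup separable semigroup are closed in the
profinite topology. -/
theorem IsSSS.mem {S : Type*} [Semigroup S] (hS : IsSSS S) {s : S} {Y : Subsemigroup S}
    (h : ∀ (P : Type) [Semigroup P] [Finite P] (φ : S →ₙ* P), ∃ y ∈ Y, φ y = φ s) : s ∈ Y := by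
  by_contra hs
  exact not_separates_iff.2 h (hS s Y hs)

/-- A limit point `s ∉ V` of `V` lies in a finite subgroup: it has an identity among its powers. -/
theorem IsSSS.exists_self_eq_mul {S : Type*} [Semigroup S] (hS : IsSSS S) {V : Set S} {s : S}
    (hs : s ∉ V) (hcl : ¬ Separates s V) : ∃ y ∈ Subsemigroup.closure {s}, s = s * y := by
  rw [not_separates_iff] at hcl
  have hss : s ∈ Subsemigroup.closure {s} := Subsemigroup.subset_closure rfl
  let D : Subsemigroup S :=
    { carrier := {x | ∃ y ∈ Subsemigroup.closure {s}, x = s * y}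
      mul_mem' := by
        rintro _ _ ⟨y, hy, rfl⟩ ⟨z, hz, rfl⟩
        exact ⟨y * (s * z), mul_mem hy (mul_mem hss hz), mul_assoc _ _ _⟩ }
  have hD : ∀ x, x ∈ D ↔ ∃ y ∈ Subsemigroup.closure {s}, x = s * y := fun _ => Iff.rfl
  have hDle : ∀ x ∈ D, x ∈ Subsemigroup.closure {s} := by
    rintro _ ⟨y, hy, rfl⟩
    exact mul_mem hss hy
  refine (hD s).1 (hS.mem fun P _ _ φ => ?_)
  have hmem : s ∈ Subsemigroup.closure {v | v ∈ V ∧ φ v = φ s} := by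
    refine hS.mem fun Q _ _ ψ => ?_
    obtain ⟨v, hv, h⟩ := hcl (P × Q) (φ.prod ψ)
    have h' := Prod.ext_iff.1 h
    exact ⟨v, Subsemigroup.subset_closure ⟨hv, h'.1⟩, h'.2⟩
  have key : ∀ x ∈ Subsemigroup.closure {v | v ∈ V ∧ φ v = φ s},
      (x ∈ V ∧ φ x = φ s) ∨ ∃ d ∈ D, φ d = φ x := by
    intro x hx
    induction hx using Subsemigroup.closure_induction with
    | mem x hx => exact Or.inl hx
    | mul x y _ _ hx hy =>
      right
      have hy' : ∃ z ∈ Subsemigroup.closure {s}, φ z = φ y := by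
        rcases hy with hy | ⟨d, hd, h⟩
        · exact ⟨s, hss, hy.2.symm⟩
        · exact ⟨d, hDle d hd, h⟩
      obtain ⟨z, hz, hzy⟩ := hy'
      rcases hx with hx | ⟨d, ⟨w, hw, rfl⟩, h⟩
      · exact ⟨s * z, ⟨z, hz, rfl⟩, by rw [map_mul, map_mul, hzy, hx.2]⟩
      · exact ⟨s * w * z, ⟨w * z, mul_mem hw hz, mul_assoc _ _ _⟩, by rw [map_mul, h, hzy, map_mul]⟩
  exact (key s hmem).resolve_left fun h => hs h.1

/-- In a strongly subsemigroup separable semigroup, right invertible elements relative to an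
idempotent are torsion. -/
theorem IsSSS.mem_closure_of_mul_eq {S : Type*} [Semigroup S] (hS : IsSSS S) {e g x : S}
    (hge : g * e = g) (hgx : g * x = e) : e ∈ Subsemigroup.closure {g} := by
  have hright : ∀ z ∈ Subsemigroup.closure {g}, z * e = z ∧ ∃ w, z * w = e := by
    intro z hz
    induction hz using Subsemigroup.closure_induction with
    | mem z hz =>
      rw [Set.mem_singleton_iff.1 hz]
      exact ⟨hge, x, hgx⟩
    | mul z y _ _ hz hy =>
      obtain ⟨hze, w, hw⟩ := hz
      obtain ⟨hye, u, hu⟩ := hy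
      exact ⟨by rw [mul_assoc, hye],
        u * w, by rw [mul_assoc, ← mul_assoc y, hu, ← mul_assoc, hze, hw]⟩
  refine hS.mem fun P _ _ φ => ?_
  have : Nonempty ((Subsemigroup.closure {g}).map φ) :=
    ⟨⟨φ g, g, Subsemigroup.subset_closure rfl, rfl⟩⟩
  obtain ⟨⟨_, z, hz, rfl⟩, hp⟩ :=
    exists_idempotent_of_finite_semigroup ((Subsemigroup.closure {g}).map φ)
  have hzz : φ z * φ z = φ z := congrArg Subtype.val hp
  obtain ⟨hze, w, hw⟩ := hright z hz
  refine ⟨z, hz, ?_⟩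
  calc φ z = φ z * φ (z * w) := by rw [hw, ← map_mul, hze]
    _ = φ e := by rw [map_mul, ← mul_assoc, hzz, ← map_mul, hw]

/-- In a strongly subsemigroup separable semigroup, any element outside a subset `V`
with `V^(n+1) ⊆ V` (for some `n ≥ 1`) can be separated from `V`. -/
theorem stmt_6 (S : Type*) [Semigroup S] (hS : IsSSS S) (n : ℕ) (hn : 1 ≤ n)
    (V : Set S) (hV : setPow V n ⊆ V) (s : S) (hs : s ∉ V) :
    Separates s V := by
  have : NeZero n := ⟨by omega⟩
  have : Finite (Multiplicative (ZMod n)) := inferInstanceAs (Finite (ZMod n))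
  by_contra hsep
  obtain ⟨e, hes, hse⟩ := hS.exists_self_eq_mul hs hsep
  have hcl := not_separates_iff.1 hsep
  have hright : ∀ z ∈ Subsemigroup.closure {s}, z * e = z ∧ z * s = s * z := by
    intro z hz
    induction hz using Subsemigroup.closure_induction with
    | mem z hz =>
      rw [Set.mem_singleton_iff.1 hz]
      exact ⟨hse.symm, rfl⟩
    | mul x y _ _ hx hy =>
      exact ⟨by rw [mul_assoc, hy.1], by rw [mul_assoc, hy.2, ← mul_assoc, hx.2, mul_assoc]⟩
  have hee : e * e = e := (hright e hes).1
  have hes' : e * s = s := (hright e hes).2.trans hse.symm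
  obtain ⟨t, ht⟩ : ∃ t, s * t = e := by
    obtain ⟨a, rfl, h | ⟨z, -, h⟩⟩ := exists_left_factor hes
    · exact ⟨e, hse.symm.trans h.symm⟩
    · exact ⟨z, h.symm⟩
  have heB : (e, (1 : Multiplicative (ZMod n))) ∈ gradedClosure V n := by
    have hsV : s ∈ Subsemigroup.closure V := hS.mem fun P _ _ φ => by
      obtain ⟨v, hv, h⟩ := hcl P φ
      exact ⟨v, Subsemigroup.subset_closure hv, h⟩
    obtain ⟨c, hc⟩ := exists_gradedClosure
      (fun v hv => ⟨_, gradedClosure_of_mem n hv⟩) hsV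
    obtain ⟨d, hd⟩ := exists_gradedClosure
      (fun a ha => ⟨c, by rwa [Set.mem_singleton_iff.1 ha]⟩) hes
    simpa [hee] using mul_mem hd (inv_mem_of_isIdempotentElem hee hd)
  have hU : s ∈ Subsemigroup.closure ((fun v => e * v * e) '' V) := by
    refine hS.mem fun P _ _ φ => ?_
    obtain ⟨v, hv, h⟩ := hcl P φ
    exact ⟨e * v * e, Subsemigroup.subset_closure ⟨v, hv, rfl⟩, by
      rw [map_mul, map_mul, h, ← map_mul, ← map_mul, hes', ← hse]⟩
  obtain ⟨g, ⟨v, hv, hvg⟩, hg⟩ := exists_left_factor hU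
  replace hvg : e * v * e = g := hvg
  have hgB : (g, Multiplicative.ofAdd 1) ∈ gradedClosure V n := by
    simpa [hvg] using mul_mem (mul_mem heB (gradedClosure_of_mem n hv)) heB
  have hge : g * e = g := by rw [← hvg, mul_assoc, hee]
  obtain ⟨x, hx⟩ : ∃ x, g * x = e := by
    rcases hg with rfl | ⟨z, -, hz⟩
    · exact ⟨t, ht⟩
    · exact ⟨z * t, by rw [← mul_assoc, ← hz, ht]⟩
  have heg : e ∈ Subsemigroup.closure {g} := hS.mem_closure_of_mul_eq hge hx
  obtain ⟨h, hhg, hgh⟩ : ∃ h ∈ Subsemigroup.closure {g}, g * h = e := by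
    obtain ⟨a, rfl, h | ⟨z, hz, h⟩⟩ := exists_left_factor heg
    · exact ⟨e, heg, hge.trans h.symm⟩
    · exact ⟨z, hz, h.symm⟩
  obtain ⟨c, hc⟩ := exists_gradedClosure (V := V) (n := n)
    (fun a ha => ⟨Multiplicative.ofAdd 1, by rwa [Set.mem_singleton_iff.1 ha]⟩) hhg
  have hec : (e, c * Multiplicative.ofAdd 1) ∈ gradedClosure V n := by
    have := mul_mem hgB hc
    rwa [Prod.mk_mul_mk, hgh, mul_comm] at this
  let C : Subsemigroup S :=
    { carrier := {x | ∃ c, (x, c) ∈ gradedClosure V n ∧ (e, c) ∈ gradedClosure V n}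
      mul_mem' := by
        rintro x y ⟨c, hc, hc'⟩ ⟨d, hd, hd'⟩
        exact ⟨c * d, mul_mem hc hd, by simpa [hee] using mul_mem hc' hd'⟩ }
  have hC : h * s ∈ C := hS.mem fun P _ _ φ => by
    obtain ⟨v, hv, hvs⟩ := hcl P φ
    exact ⟨h * v, ⟨_, mul_mem hc (gradedClosure_of_mem n hv), hec⟩, by
      rw [map_mul, map_mul, hvs]⟩
  obtain ⟨d, hd, hed⟩ := hC
  have := mul_mem (mul_mem hgB hd) (inv_mem_of_isIdempotentElem hee hed)
  rw [Prod.mk_mul_mk, Prod.mk_mul_mk, ← mul_assoc, hgh, hes', ← hse, mul_inv_cancel_right] at this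
  exact hs (mem_of_gradedClosure hV this)
end

section
/- A finite semigroup P is strongly subsemigroup separability preserving if and only if every element p ∈ P either is indecomposable (p ∉ P², i.e. p is not a product of two elements of P) or belongs to a subgroup of P (a subsemigroup of P that is a group). -/
/-- `p` belongs to a subgroup of `P`: some subsemigroup of `P` containing `p`
is a group (it has a two-sided identity and two-sided inverses). -/
def MemSubgroup {P : Type*} [Semigroup P] (p : P) : Prop :=
  ∃ H : Subsemigroup P, p ∈ H ∧ ∃ e ∈ H,
    (∀ h ∈ H, e * h = h ∧ h * e = h) ∧ ∀ h ∈ H, ∃ h' ∈ H, h * h' = e ∧ h' * h = e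
/-- `T` preserves strong subsemigroup separability in direct products. -/
def SSSPreserving (T : Type*) [Semigroup T] : Prop :=
  ∀ (S : Type*) [Semigroup S], IsSSS S → IsSSS (S × T)

namespace Separates

variable {S : Type*} [Semigroup S] {s : S} {A B : Set S}

theorem iff_forall : Separates s A ↔ ∃ (Q : Type) (_ : Semigroup Q) (_ : Finite Q)
    (φ : S →ₙ* Q), ∀ t ∈ A, φ t ≠ φ s := by
  simp [Separates]

theorem mono (h : Separates s B) (hAB : A ⊆ B) : Separates s A := by
  obtain ⟨Q, _, _, φ, hφ⟩ := h
  exact ⟨Q, _, ‹_›, φ, fun hs => hφ (Set.image_mono hAB hs)⟩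

theorem union (hA : Separates s A) (hB : Separates s B) : Separates s (A ∪ B) := by
  rw [iff_forall] at *
  obtain ⟨Q, _, _, φ, hφ⟩ := hA
  obtain ⟨R, _, _, ψ, hψ⟩ := hB
  refine ⟨Q × R, inferInstance, inferInstance, φ.prod ψ, ?_⟩
  rintro t (ht | ht) h
  · exact hφ t ht (congrArg Prod.fst h)
  · exact hψ t ht (congrArg Prod.snd h)

/-- Finite semigroups in any universe may be used to separate. -/
theorem of_finite {Q : Type*} [Semigroup Q] [Finite Q] (φ : S →ₙ* Q)
    (h : ∀ t ∈ A, φ t ≠ φ s) : Separates s A := by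
  rw [iff_forall]
  refine ⟨Shrink.{0} Q, inferInstance, inferInstance,
    ((Shrink.mulEquiv.symm : Q ≃* Shrink.{0} Q) : Q →ₙ* Shrink.{0} Q).comp φ, fun t ht hts => h t ht ?_⟩
  exact Shrink.mulEquiv.symm.injective hts

/-- An indecomposable element is separated from every set avoiding it. -/
theorem of_indecomposable (hs : ∀ a b : S, a * b ≠ s) (hA : s ∉ A) : Separates s A := by
  let _ : Semigroup Prop := { mul := fun _ _ => False, mul_assoc := fun _ _ _ => rfl }
  refine of_finite (Q := Prop)
    { toFun := fun t => t = s, map_mul' := fun a b => eq_false (hs a b) } fun t ht h => ?_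
  obtain rfl : t = s := (iff_of_eq h).2 rfl
  exact hA ht

theorem prodMk {P : Type*} [Semigroup P] [Finite P] {p : P} {U : Set (S × P)}
    (h : Separates s {t | (t, p) ∈ U}) : Separates (s, p) U := by
  rw [iff_forall] at h
  obtain ⟨Q, _, _, φ, hφ⟩ := h
  refine of_finite (φ.prodMap (MulHom.id P)) ?_
  rintro ⟨t, q⟩ ht hq
  obtain ⟨h1, h2⟩ := Prod.ext_iff.1 hq
  obtain rfl : q = p := h2
  exact hφ t ht h1

end Separates

namespace Subsemigroup

variable {S : Type*} [Semigroup S]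

theorem eq_mul_of_mem_closure {E : Set S} {t : S} (ht : t ∈ closure E) :
    t ∈ E ∨ ∃ v ∈ closure E, ∃ u ∈ E, t = v * u := by
  induction ht using closure_induction with
  | mem x hx => exact .inl hx
  | mul x y hx _ _ ihy =>
    right
    obtain hy | ⟨v, hv, u, hu, rfl⟩ := ihy
    · exact ⟨x, hx, y, hy, rfl⟩
    · exact ⟨x * v, mul_mem hx hv, u, hu, (mul_assoc _ _ _).symm⟩

theorem eq_mul_of_mem_closure' {E : Set S} {t : S} (ht : t ∈ closure E) :
    t ∈ E ∨ ∃ u ∈ E, ∃ v ∈ closure E, t = u * v := by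
  induction ht using closure_induction with
  | mem x hx => exact .inl hx
  | mul x y _ hy ihx _ =>
    right
    obtain hx | ⟨u, hu, v, hv, rfl⟩ := ihx
    · exact ⟨x, hx, y, hy, rfl⟩
    · exact ⟨u, hu, v * y, mul_mem hv hy, mul_assoc _ _ _⟩

end Subsemigroup

section Group

variable {S G : Type*} [Semigroup S] [Group G] (U : Subsemigroup (S × G))

/-- An element of `U` has a power in `U` whose group component is inverted. -/
theorem exists_mem_inv [Finite G] {v : S} {h : G} (hv : (v, h) ∈ U) :
    ∃ v', (v', h⁻¹) ∈ U ∧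
      ∀ B : Set S, (∀ b ∈ B, v * b ∈ B) → ∀ b ∈ B, v' * b ∈ B := by
  have key (k : ℕ) : ∃ v', (v', h ^ (k + 1)) ∈ U ∧
      ∀ B : Set S, (∀ b ∈ B, v * b ∈ B) → ∀ b ∈ B, v' * b ∈ B := by
    induction k with
    | zero => exact ⟨v, by simpa using hv, fun B hB => hB⟩
    | succ k ih =>
      obtain ⟨v', hv', hB⟩ := ih
      refine ⟨v' * v, ?_, fun B h b hb => ?_⟩
      · rw [pow_succ]
        exact U.mul_mem hv' hv
      · rw [mul_assoc]
        exact hB B h _ (h b hb)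
  obtain ⟨v', hv', hB⟩ := key (2 * orderOf h - 2)
  refine ⟨v', ?_, hB⟩
  convert hv' using 2
  rw [inv_eq_iff_mul_eq_one, ← pow_succ']
  have := orderOf_pos h
  rw [show 2 * orderOf h - 2 + 1 + 1 = orderOf h * 2 by omega, pow_mul, pow_orderOf_eq_one,
    one_pow]

variable {U}

theorem separates_of_eq_mul_mul (hS : IsSSS S) {s y z : S} {g : G} (hs : (s, g) ∉ U)
    (hy : (y, g) ∈ U) (hz : (z, g⁻¹) ∈ U) (h : s = y * (z * s)) :
    Separates s {t | (t, g) ∈ U} := by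
  let U₁ : Subsemigroup S :=
    { carrier := {t | (t, (1 : G)) ∈ U}
      mul_mem' := fun {a b} ha hb => by
        have := U.mul_mem ha hb
        rwa [Prod.mk_mul_mk, one_mul] at this }
  have hzs : z * s ∉ U₁ := fun hzs => hs <| by
    have : (y * (z * s), g * 1) ∈ U := U.mul_mem hy hzs
    rwa [mul_one, ← h] at this
  have h₁ := hS _ U₁ hzs
  rw [Separates.iff_forall] at h₁ ⊢
  obtain ⟨Q, _, _, φ, hφ⟩ := h₁
  refine ⟨Q, _, ‹_›, φ, fun t ht hts => hφ (z * t) ?_ (by simp [hts])⟩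
  have : (z * t, g⁻¹ * g) ∈ U := U.mul_mem hz ht
  rwa [inv_mul_cancel] at this

theorem mem_fst_of_mem_closure {E : Set S} (hE : ∀ t ∈ E, ∃ h, (t, h) ∈ U) {t : S}
    (ht : t ∈ Subsemigroup.closure E) : ∃ h, (t, h) ∈ U := by
  induction ht using Subsemigroup.closure_induction with
  | mem x hx => exact hE x hx
  | mul x y _ _ hx hy =>
    obtain ⟨a, ha⟩ := hx
    obtain ⟨b, hb⟩ := hy
    exact ⟨a * b, U.mul_mem ha hb⟩

/-- The elements of the fibre over `g` which are left multiples of `s`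
already decide whether `s` can be separated from the fibre. -/
theorem separates_fiber_of_separates [Finite G] (hS : IsSSS S) {s : S} {g : G} (hs : (s, g) ∉ U)
    (h : Separates s {x | (x, g) ∈ U ∧ ∃ v k, (v, k) ∈ U ∧ x = v * s}) :
    Separates s {t | (t, g) ∈ U} := by
  let D : Set S := {u | (u, g) ∈ U ∧ ∃ v k, (v, k) ∈ U ∧ s = v * u}
  let E : Set S := {u | (u, g) ∈ U} \ D
  have hE : Separates s E := by
    refine (hS s (Subsemigroup.closure E) fun hsE => ?_).mono Subsemigroup.subset_closure
    obtain hsE | ⟨v, hv, u, hu, rfl⟩ := Subsemigroup.eq_mul_of_mem_closure hsE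
    · exact hs hsE.1
    · obtain ⟨k, hk⟩ := mem_fst_of_mem_closure (fun t ht => ⟨g, ht.1⟩) hv
      exact hu.2 ⟨hu.1, v, k, hk, rfl⟩
  have hD : Separates s D := by
    rw [Separates.iff_forall] at h ⊢
    obtain ⟨Q, _, _, φ, hφ⟩ := h
    refine ⟨Q, _, ‹_›, φ, ?_⟩
    rintro u ⟨hu, v, k, hv, hsu⟩ hus
    obtain ⟨v', hv', hB⟩ := exists_mem_inv U hv
    refine hφ (v' * s) ⟨?_, v', _, hv', rfl⟩ (hB {b | φ b = φ s} (fun b hb => ?_) s rfl)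
    · have : (v' * (v * u), k⁻¹ * (k * g)) ∈ U := U.mul_mem hv' (U.mul_mem hv hu)
      rwa [inv_mul_cancel_left, ← hsu] at this
    · change φ (v * b) = φ s
      rw [map_mul, show φ b = φ s from hb, ← hus, ← map_mul, ← hsu, hus]
  refine (hD.union hE).mono fun t ht => ?_
  by_cases htD : t ∈ D
  · exact .inl htD
  · exact .inr ⟨ht, htD⟩

theorem separates_fiber [Finite G] (hS : IsSSS S) {s : S} {g : G} (hs : (s, g) ∉ U) :
    Separates s {t | (t, g) ∈ U} := by
  let X : Set S := {x | (x, g) ∈ U ∧ ∃ v k, (v, k) ∈ U ∧ x = v * s}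
  by_cases hX : s ∈ Subsemigroup.closure X
  · obtain hX | ⟨y, hy, m, hm, hsm⟩ := Subsemigroup.eq_mul_of_mem_closure' hX
    · exact absurd hX.1 hs
    have hm' : ∃ z k, (z, k) ∈ U ∧ m = z * s := by
      obtain hm | ⟨v, hv, u, ⟨_, w, k, hw, rfl⟩, rfl⟩ := Subsemigroup.eq_mul_of_mem_closure hm
      · exact hm.2
      · obtain ⟨l, hl⟩ := mem_fst_of_mem_closure (fun t ht => ⟨g, ht.1⟩) hv
        exact ⟨v * w, l * k, U.mul_mem hl hw, (mul_assoc _ _ _).symm⟩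
    obtain ⟨z, k, hz, rfl⟩ := hm'
    obtain ⟨w, hw, hB⟩ := exists_mem_inv U (U.mul_mem hy.1 hz)
    have hws : w * s = s := hB {s} (by simp [mul_assoc, ← hsm]) s rfl
    refine separates_of_eq_mul_mul hS hs hy.1 (z := z * w) ?_ (by rw [mul_assoc, hws, ← hsm])
    have : (z * w, k * (g * k)⁻¹) ∈ U := U.mul_mem hz hw
    rwa [mul_inv_rev, mul_inv_cancel_left] at this
  · exact separates_fiber_of_separates hS hs
      ((hS s _ hX).mono Subsemigroup.subset_closure)

end Group

theorem MemSubgroup.exists_group {P : Type*} [Semigroup P] {p : P} (hp : MemSubgroup p) :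
    ∃ (H : Subsemigroup P) (_ : Group H) (ι : H →ₙ* P) (g : H), ι g = p := by
  obtain ⟨H, hpH, e, he, hid, hinv⟩ := hp
  choose! inv hinvH hinv using hinv
  let _ : Group H :=
    { (inferInstance : Semigroup H) with
      one := ⟨e, he⟩
      one_mul := fun a => Subtype.ext (hid a a.2).1
      mul_one := fun a => Subtype.ext (hid a a.2).2
      inv := fun a => ⟨inv a, hinvH a a.2⟩
      inv_mul_cancel := fun a => Subtype.ext (hinv a a.2).2 }
  exact ⟨H, inferInstance, ⟨Subtype.val, fun _ _ => rfl⟩, ⟨p, hpH⟩, rfl⟩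

theorem SSSPreserving.of_indecomposable_or_memSubgroup {P : Type*} [Semigroup P] [Finite P]
    (h : ∀ p : P, (¬ ∃ a b : P, a * b = p) ∨ MemSubgroup p) : SSSPreserving P := by
  rintro S _ hS ⟨s, p⟩ U hsU
  obtain hp | hp := h p
  · exact Separates.of_indecomposable
      (fun a b hab => hp ⟨a.2, b.2, congrArg Prod.snd hab⟩) hsU
  · obtain ⟨H, _, ι, g, rfl⟩ := hp.exists_group
    exact Separates.prodMk (p := ι g) (U := (U : Set (S × P)))
      (separates_fiber (U := U.comap ((MulHom.id S).prodMap ι)) hS hsU)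

theorem memSubgroup_of_eq_mul {P : Type*} [Semigroup P] {p q : P}
    (hq : q ∈ Subsemigroup.closure {p}) (h : p = p * q) : MemSubgroup p := by
  have hpc : ∀ x ∈ Subsemigroup.closure {p}, p * x = x * p := by
    intro x hx
    induction hx using Subsemigroup.closure_induction with
    | mem x hx => obtain rfl : x = p := hx; rfl
    | mul x y _ _ hx hy => rw [← mul_assoc, hx, mul_assoc, hy, mul_assoc]
  have hcomm : ∀ x ∈ Subsemigroup.closure {p}, ∀ y ∈ Subsemigroup.closure {p},
      x * y = y * x := by
    intro x hx y hy
    induction hx using Subsemigroup.closure_induction with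
    | mem x hx => obtain rfl : x = p := hx; exact hpc y hy
    | mul x z _ _ hx hz => rw [mul_assoc, hz, ← mul_assoc, hx, mul_assoc]
  have hp : p ∈ Subsemigroup.closure {p} := Subsemigroup.subset_closure rfl
  have hqx : ∀ x ∈ Subsemigroup.closure {p}, q * x = x := by
    intro x hx
    induction hx using Subsemigroup.closure_induction with
    | mem x hx => obtain rfl : x = p := hx; rw [← hpc q hq, ← h]
    | mul x y _ _ hx _ => rw [← mul_assoc, hx]
  have hinv : ∀ x ∈ Subsemigroup.closure {p}, ∃ y ∈ Subsemigroup.closure {p}, x * y = q := by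
    intro x hx
    induction hx using Subsemigroup.closure_induction with
    | mem x hx =>
      obtain rfl : x = p := hx
      obtain hq' | ⟨u, hu, v, hv, huv⟩ := Subsemigroup.eq_mul_of_mem_closure' hq
      · obtain rfl : q = x := hq'
        exact ⟨q, hq, h.symm⟩
      · obtain rfl : u = x := hu
        exact ⟨v, hv, huv.symm⟩
    | mul x y hx hy ihx ihy =>
      obtain ⟨x', hx', h1⟩ := ihx
      obtain ⟨y', hy', h2⟩ := ihy
      refine ⟨y' * x', mul_mem hy' hx', ?_⟩
      rw [mul_assoc, ← mul_assoc y, h2, hqx x' hx', h1]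
  refine ⟨Subsemigroup.closure {p}, hp, q, hq, fun x hx => ⟨hqx x hx, ?_⟩, fun x hx => ?_⟩
  · rw [hcomm x hx q hq, hqx x hx]
  · obtain ⟨y, hy, hxy⟩ := hinv x hx
    exact ⟨y, hy, hxy, by rw [hcomm y hy x hx, hxy]⟩

theorem isSSS_multiplicative_of_module_zmod_two (V : Type*) [AddCommGroup V]
    [Module (ZMod 2) V] : IsSSS (Multiplicative V) := by
  intro s Y hs
  obtain hY | ⟨y, hy⟩ := (Y : Set (Multiplicative V)).eq_empty_or_nonempty
  · exact ⟨Unit, inferInstance, inferInstance, ⟨fun _ => (), fun _ _ => rfl⟩, by simp [hY]⟩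
  have hadd : ∀ a : V, a + a = 0 := fun a => ZModModule.add_self a
  have h0 : Multiplicative.ofAdd (0 : V) ∈ Y := by
    have := Y.mul_mem hy hy
    rwa [show y * y = Multiplicative.ofAdd (0 : V) from hadd _] at this
  let M : Submodule (ZMod 2) V :=
    { carrier := {v | Multiplicative.ofAdd v ∈ Y}
      add_mem' := fun ha hb => Y.mul_mem ha hb
      zero_mem' := h0
      smul_mem' := fun c v hv => by
        obtain rfl | rfl : c = 0 ∨ c = 1 := by revert c; decide
        · simpa using h0
        · simpa using hv }
  obtain ⟨f, hfs, hf⟩ := Submodule.exists_le_ker_of_notMem (K := ZMod 2) (p := M) (v := s.toAdd) hs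
  rw [Separates.iff_forall]
  refine ⟨Multiplicative (ZMod 2), inferInstance, inferInstanceAs (Finite (ZMod 2)),
    (AddMonoidHom.toMultiplicative f.toAddMonoidHom : _ →* _), fun t ht hts => hfs ?_⟩
  have h1 : f t.toAdd = 0 := hf (show t.toAdd ∈ M from ht)
  have h2 : f t.toAdd = f s.toAdd := hts
  rw [← h2, h1]

/-- In a product with an infinite group, a point over a decomposable element cannot be
separated from the rest of its fibre. -/
theorem not_separates_of_infinite_group {G P : Type*} [Group G] [Infinite G] [Semigroup P]
    (a b : P) {U : Set (G × P)} (hU : ∀ x : G, x ≠ 1 → (x, a * b) ∈ U) :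
    ¬ Separates ((1 : G), a * b) U := by
  rw [Separates.iff_forall]
  rintro ⟨Q, _, _, φ, hφ⟩
  obtain ⟨c, d, hcd, h⟩ := Finite.exists_ne_map_eq_of_infinite fun c : G => φ (c, a)
  refine hφ (d * c⁻¹, a * b) (hU _ fun h1 => hcd (mul_inv_eq_one.1 h1).symm) ?_
  rw [← Prod.mk_mul_mk, map_mul, ← show φ (c, a) = φ (d, a) from h, ← map_mul, Prod.mk_mul_mk,
    mul_inv_cancel]

theorem SSSPreserving.memSubgroup_mul {P : Type*} [Semigroup P]
    (h : SSSPreserving P) (a b : P) : MemSubgroup (a * b) := by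
  by_contra hp
  let G := Multiplicative (ULift ℕ →₀ ZMod 2)
  have : Infinite G := inferInstanceAs (Infinite (ULift ℕ →₀ ZMod 2))
  let X : Set (G × P) := {x | x.1 ≠ 1 ∧ x.2 = a * b}
  refine not_separates_of_infinite_group a b (G := G)
    (U := Subsemigroup.closure X) (fun x hx => Subsemigroup.subset_closure ⟨hx, rfl⟩)
    (h G (isSSS_multiplicative_of_module_zmod_two _) _ _ fun hmem => ?_)
  obtain h1 | ⟨u, hu, v, hv, huv⟩ := Subsemigroup.eq_mul_of_mem_closure' hmem
  · exact h1.1 rfl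
  · refine hp (memSubgroup_of_eq_mul (q := v.2) ?_ ?_)
    · have : Subsemigroup.closure X ≤
          (Subsemigroup.closure {a * b}).comap (MulHom.snd G P) :=
        Subsemigroup.closure_le.2 fun x hx => Subsemigroup.subset_closure hx.2
      exact this hv
    · conv_rhs => rw [← hu.2]
      exact congrArg Prod.snd huv

/-- A finite semigroup `P` is strong-subsemigroup-separability preserving iff every
element of `P` is indecomposable or belongs to a subgroup of `P`. -/
theorem stmt_7 (P : Type*) [Semigroup P] [Finite P] :
    SSSPreserving P ↔ ∀ p : P, (¬ ∃ a b : P, a * b = p) ∨ MemSubgroup p := by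
  refine ⟨fun h p => ?_, SSSPreserving.of_indecomposable_or_memSubgroup⟩
  by_cases hp : ∃ a b : P, a * b = p
  · obtain ⟨a, b, rfl⟩ := hp
    exact .inr (h.memSubgroup_mul a b)
  · exact .inl hp
end

section
/- A finite monoid M is strongly subsemigroup separability preserving if and only if M is a union of groups, i.e. every element of M belongs to a subgroup of M. -/
theorem Separates.mono_s8 {S : Type*} [Semigroup S] {s : S} {Y Z : Set S} (h : Separates s Z)
    (hYZ : Y ⊆ Z) : Separates s Y := by
  obtain ⟨P, hP, hf, φ, hφ⟩ := h
  exact ⟨P, hP, hf, φ, fun hs => hφ (Set.image_mono hYZ hs)⟩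

theorem Separates.union_s8 {S : Type*} [Semigroup S] {s : S} {Y Z : Set S} (hY : Separates s Y)
    (hZ : Separates s Z) : Separates s (Y ∪ Z) := by
  obtain ⟨P, hP, hPf, φ, hφ⟩ := hY
  obtain ⟨Q, hQ, hQf, ψ, hψ⟩ := hZ
  refine ⟨P × Q, inferInstance, inferInstance, φ.prod ψ, ?_⟩
  rintro ⟨x, hx | hx, hxs⟩
  · exact hφ ⟨x, hx, congrArg Prod.fst hxs⟩
  · exact hψ ⟨x, hx, congrArg Prod.snd hxs⟩

/-- The finite semigroup separating `s` from `Y` may live in any universe. -/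
theorem separates_of_mulHom {S P : Type*} [Semigroup S] [Semigroup P] [Finite P] {s : S}
    {Y : Set S} (φ : S →ₙ* P) (h : φ s ∉ φ '' Y) : Separates s Y := by
  refine ⟨Shrink.{0} P, inferInstance, inferInstance,
    ((Shrink.mulEquiv.{0} (α := P)).symm : P →ₙ* Shrink.{0} P).comp φ, ?_⟩
  rintro ⟨x, hx, hxs⟩
  exact h ⟨x, hx, Shrink.mulEquiv.symm.injective hxs⟩

theorem Separates.comap {S T : Type*} [Semigroup S] [Semigroup T] (f : S →ₙ* T) {s : S}
    {Y : Set T} (h : Separates (f s) Y) : Separates s (f ⁻¹' Y) := by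
  obtain ⟨P, hP, hf, φ, hφ⟩ := h
  refine ⟨P, hP, hf, φ.comp f, ?_⟩
  rintro ⟨x, hx, hxs⟩
  exact hφ ⟨f x, hx, hxs⟩

theorem IsSSS.withOne {S : Type*} [Semigroup S] (hS : IsSSS S) : IsSSS (WithOne S) := by
  intro s Y hs
  induction s using WithOne.recOneCoe with
  | one =>
    let φ : S →ₙ* Unit := ⟨fun _ => (), fun _ _ => rfl⟩
    have : Finite (WithOne Unit) := inferInstanceAs (Finite (Option Unit))
    refine ⟨WithOne Unit, inferInstance, inferInstance, (WithOne.mapMulHom φ : _ →ₙ* _), ?_⟩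
    rintro ⟨y, hy, hys⟩
    induction y using WithOne.recOneCoe with
    | one => exact hs hy
    | coe b => simp at hys
  | coe a =>
    obtain ⟨P, hP, hf, φ, hφ⟩ := hS a (Y.comap WithOne.coeMulHom) hs
    have : Finite (WithOne P) := inferInstanceAs (Finite (Option P))
    refine ⟨WithOne P, inferInstance, inferInstance, (WithOne.mapMulHom φ : _ →ₙ* _), ?_⟩
    rintro ⟨y, hy, hys⟩
    induction y using WithOne.recOneCoe with
    | one => simp at hys
    | coe b => exact hφ ⟨b, hy, WithOne.coe_injective (by simpa using hys)⟩

theorem Subsemigroup.pow_mem_of_pos {S : Type*} [Monoid S] (U : Subsemigroup S) {u : S}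
    (hu : u ∈ U) {n : ℕ} (hn : 0 < n) : u ^ n ∈ U := by
  induction n, hn using Nat.le_induction with
  | base => simpa using hu
  | succ n _ ih => rw [pow_succ]; exact U.mul_mem ih hu

theorem isIdempotentElem_pow_of_pow_succ_eq {S : Type*} [Monoid S] {x : S} {k : ℕ} (hk : 0 < k)
    (hx : x ^ (k + 1) = x) : IsIdempotentElem (x ^ k) := by
  obtain ⟨k, rfl⟩ := Nat.exists_eq_succ_of_ne_zero hk.ne'
  calc x ^ (k + 1) * x ^ (k + 1) = x ^ (k + 1 + 1) * x ^ k := by rw [← pow_add, ← pow_add]; ring_nf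
    _ = x ^ (k + 1) := by rw [hx, ← pow_succ']

theorem pow_mul_eq_of_pow_succ_eq {S : Type*} [Monoid S] {x : S} {k : ℕ} (hk : 0 < k)
    (hx : x ^ (k + 1) = x) {n : ℕ} (hn : 0 < n) : x ^ (k * n) = x ^ k := by
  rw [pow_mul]
  exact (isIdempotentElem_pow_of_pow_succ_eq hk hx).pow_eq hn.ne'

/-- In a strongly subsemigroup separable monoid, right units of a local submonoid have finite
order. -/
theorem IsSSS.exists_pow_eq_of_mul_eq {S : Type*} [Monoid S] (hS : IsSSS S) {f a c : S}
    (haf : a * f = a) (hac : a * c = f) : ∃ n, 0 < n ∧ a ^ n = f := by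
  by_contra! h
  let V : Subsemigroup S :=
    { carrier := {y | ∃ n, 0 < n ∧ a ^ n = y}
      mul_mem' := by
        rintro _ _ ⟨i, hi, rfl⟩ ⟨j, hj, rfl⟩
        exact ⟨i + j, by omega, pow_add a i j⟩ }
  obtain ⟨P, hP, hf, φ, hφ⟩ := hS f V (by rintro ⟨n, hn, h'⟩; exact h n hn h')
  obtain ⟨i, j, hij, hφij⟩ : ∃ i j : ℕ, i < j ∧ φ (a ^ i) = φ (a ^ j) := by
    obtain ⟨i, j, hne, h⟩ := Finite.exists_ne_map_eq_of_infinite fun i : ℕ => φ (a ^ i)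
    rcases hne.lt_or_gt with hlt | hlt
    · exact ⟨i, j, hlt, h⟩
    · exact ⟨j, i, hlt, h.symm⟩
  have hcancel : ∀ n p : ℕ, 0 < p → a ^ (p + n) * c ^ n = a ^ p := by
    intro n p hp
    induction n with
    | zero => simp
    | succ n ih =>
      obtain ⟨q, hq⟩ := Nat.exists_eq_succ_of_ne_zero (show p + n ≠ 0 by omega)
      calc a ^ (p + (n + 1)) * c ^ (n + 1) = a ^ (p + n) * (a * c) * c ^ n := by
            rw [← add_assoc, pow_succ, pow_succ']; simp only [mul_assoc]
        _ = a ^ p := by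
            rw [hac, hq, Nat.succ_eq_add_one, pow_succ, mul_assoc _ a f, haf, ← pow_succ,
              ← Nat.succ_eq_add_one, ← hq, ih]
  apply hφ
  refine ⟨a ^ (1 + (j - i)) * c, ⟨j - i, by omega, ?_⟩, ?_⟩
  · simpa [add_comm] using (hcancel 1 (j - i) (by omega)).symm
  · have h1 : φ (a * c) = φ (a ^ (1 + i) * c ^ i * c) := by rw [hcancel i 1 one_pos, pow_one]
    have h2 : a ^ (1 + (j - i)) * c = a ^ (1 + j) * c ^ i * c := by
      rw [← hcancel i (1 + (j - i)) (by omega)]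
      congr 3
      omega
    rw [h2, ← hac, h1, pow_add, pow_add]
    simp only [map_mul, hφij]

/-- In a strongly subsemigroup separable monoid, an element differing from all its higher powers
is separable from every set avoiding it. -/
theorem IsSSS.separates_of_pow_ne {S : Type*} [Monoid S] (hS : IsSSS S) {s : S}
    (hpow : ∀ i, 2 ≤ i → s ^ i ≠ s) {X : Set S} (hs : s ∉ X) : Separates s X := by
  let V : Subsemigroup S :=
    { carrier := {y | ∃ i, 2 ≤ i ∧ s ^ i = y}
      mul_mem' := by
        rintro _ _ ⟨i, hi, rfl⟩ ⟨j, hj, rfl⟩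
        exact ⟨i + j, by omega, pow_add s i j⟩ }
  obtain ⟨P, hP, hf, φ, hφ⟩ := hS s V (by rintro ⟨i, hi, h⟩; exact hpow i hi h)
  let T : Subsemigroup S :=
    { carrier := {y | (∃ i, 2 ≤ i ∧ φ y = φ (s ^ i)) ∨ (y ∈ X ∧ φ y = φ s)}
      mul_mem' := by
        intro a b ha hb
        have key : ∀ y, ((∃ i, 2 ≤ i ∧ φ y = φ (s ^ i)) ∨ (y ∈ X ∧ φ y = φ s)) →
            ∃ i, 1 ≤ i ∧ φ y = φ (s ^ i) := by
          rintro y (⟨i, hi, h⟩ | ⟨-, h⟩)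
          · exact ⟨i, by omega, h⟩
          · exact ⟨1, le_rfl, by rw [h, pow_one]⟩
        obtain ⟨i, hi, hai⟩ := key a ha
        obtain ⟨j, hj, hbj⟩ := key b hb
        exact .inl ⟨i + j, by omega, by rw [map_mul, hai, hbj, pow_add, map_mul]⟩ }
  have hT : Separates s (T : Set S) := by
    apply hS
    rintro (⟨i, hi, h⟩ | ⟨h, -⟩)
    · exact hφ ⟨s ^ i, ⟨i, hi, rfl⟩, h.symm⟩
    · exact hs h
  have hC : Separates s {x | φ x ≠ φ s} := ⟨P, hP, hf, φ, by rintro ⟨x, hx, h⟩; exact hx h⟩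
  refine (hT.union_s8 hC).mono_s8 fun x hx => ?_
  by_cases h : φ x = φ s
  · exact .inl (.inr ⟨hx, h⟩)
  · exact .inr h

/-- If `m` lies in a subgroup, then the fibre over `m` of a subsemigroup of `S × M` is separable
from any element of its complement. -/
theorem IsSSS.separates_fiber {S M : Type*} [Monoid S] [Monoid M] (hS : IsSSS S) {m : M} {k : ℕ}
    (hk : 0 < k) (hm : m ^ (k + 1) = m) (U : Subsemigroup (S × M)) {s : S} (hs : (s, m) ∉ U) :
    Separates s {x | (x, m) ∈ U} := by
  by_cases hpow : ∀ i, 2 ≤ i → s ^ i ≠ s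
  · exact hS.separates_of_pow_ne hpow hs
  push Not at hpow
  obtain ⟨j, hj, hsj⟩ : ∃ j, 0 < j ∧ s ^ (j + 1) = s := by
    obtain ⟨i, hi, h⟩ := hpow
    exact ⟨i - 1, by omega, by rwa [Nat.sub_add_cancel (by omega)]⟩
  by_cases hU : ∀ i, 0 < i → (s, m ^ i) ∉ U
  · let V : Subsemigroup S :=
      { carrier := {x | ∃ i, 0 < i ∧ (x, m ^ i) ∈ U}
        mul_mem' := by
          rintro a b ⟨i, hi, ha⟩ ⟨l, hl, hb⟩
          exact ⟨i + l, by omega, by simpa [pow_add] using U.mul_mem ha hb⟩ }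
    refine (hS s V (by rintro ⟨i, hi, h⟩; exact hU i hi h)).mono_s8 fun x hx => ?_
    exact ⟨1, one_pos, by simpa using hx⟩
  push Not at hU
  obtain ⟨i, hi, hsU⟩ := hU
  set f := s ^ j with hf
  have hff : f * f = f := isIdempotentElem_pow_of_pow_succ_eq hj hsj
  have hfs : f * s = s := by rw [hf, ← pow_succ, hsj]
  have hsf : s * f = s := by rw [hf, ← pow_succ', hsj]
  have hfU : (f, m ^ k) ∈ U := by
    have h := U.pow_mem_of_pos hsU (mul_pos hj hk)
    rw [Prod.pow_mk, pow_mul_eq_of_pow_succ_eq hj hsj hk, ← pow_mul,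
      show i * (j * k) = k * (i * j) by ring, pow_mul_eq_of_pow_succ_eq hk hm (mul_pos hi hj)] at h
    exact h
  by_cases hx : ∃ x, (x, m) ∈ U ∧ ∃ n, 0 < n ∧ (f * x * f) ^ n = f
  · obtain ⟨x, hxU, n, hn, hxn⟩ := hx
    set y := f * x * f with hy
    have hyU : (y, m) ∈ U := by
      have h := U.mul_mem (U.mul_mem hfU hxU) hfU
      rwa [Prod.mk_mul_mk, Prod.mk_mul_mk, ← pow_succ, hm, ← pow_succ', hm] at h
    obtain ⟨r, hr⟩ := Nat.exists_eq_succ_of_ne_zero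
      (show k * (n * 2) - 1 ≠ 0 by have := mul_pos hk hn; rw [← mul_assoc]; omega)
    have hr' : r.succ + 1 = k * (n * 2) := by omega
    have hmr : m ^ (r.succ + 1) = m ^ k := by
      rw [hr', pow_mul_eq_of_pow_succ_eq hk hm (by omega)]
    have hyr : y ^ (r.succ + 1) = f := by
      rw [hr', show k * (n * 2) = n * (2 * k) by ring, pow_mul, hxn]
      exact IsIdempotentElem.pow_eq hff (by omega)
    have hzU : (y ^ r.succ, m ^ r.succ) ∈ U := U.pow_mem_of_pos hyU r.succ_pos
    let W : Subsemigroup S :=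
      { carrier := {x | (x, m ^ k) ∈ U}
        mul_mem' := by
          intro a b ha hb
          have h := U.mul_mem ha hb
          rwa [Prod.mk_mul_mk, (isIdempotentElem_pow_of_pow_succ_eq hk hm).eq] at h }
    have hW : y ^ r.succ * s ∉ W := by
      intro h
      have h' := U.mul_mem hyU h
      rw [Prod.mk_mul_mk, ← mul_assoc, ← pow_succ', ← pow_succ', hyr, hfs, hm] at h'
      exact hs h'
    obtain ⟨P, hP, hPf, φ, hφ⟩ := hS _ W hW
    refine ⟨P, hP, hPf, φ, ?_⟩
    rintro ⟨w, hw, hws⟩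
    refine hφ ⟨y ^ r.succ * w, ?_, by rw [map_mul, map_mul, hws]⟩
    have h := U.mul_mem hzU hw
    rw [Prod.mk_mul_mk, ← pow_succ, hmr] at h
    exact h
  · push Not at hx
    let T : Subsemigroup S :=
      { carrier := {y | f * y = y ∧ y * f = y ∧ ∀ n, 0 < n → y ^ n ≠ f}
        mul_mem' := by
          rintro a b ⟨hfa, haf, ha⟩ ⟨hfb, hbf, hb⟩
          refine ⟨by rw [← mul_assoc, hfa], by rw [mul_assoc, hbf], fun n hn hab => ?_⟩
          obtain ⟨p, rfl⟩ := Nat.exists_eq_succ_of_ne_zero hn.ne'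
          rw [Nat.succ_eq_add_one, pow_succ', mul_assoc] at hab
          obtain ⟨l, hl, h⟩ := hS.exists_pow_eq_of_mul_eq haf hab
          exact ha l hl h }
    obtain ⟨P, hP, hPf, φ, hφ⟩ := hS s T fun h => h.2.2 j hj rfl
    refine ⟨P, hP, hPf, φ, ?_⟩
    rintro ⟨x, hxU, hxs⟩
    refine hφ ⟨f * x * f, ⟨?_, ?_, hx x hxU⟩, ?_⟩
    · rw [← mul_assoc, ← mul_assoc, hff]
    · rw [mul_assoc, hff]
    · rw [map_mul, map_mul, hxs, ← map_mul, ← map_mul, hfs, hsf]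

theorem MemSubgroup.exists_pow_succ_eq {M : Type*} [Monoid M] [Finite M] {m : M}
    (h : MemSubgroup m) : ∃ k, 0 < k ∧ m ^ (k + 1) = m := by
  obtain ⟨H, hmH, e, he, hid, hinv⟩ := h
  obtain ⟨m', hm', hmm', -⟩ := hinv m hmH
  obtain ⟨i, k, hk, hik⟩ : ∃ i k : ℕ, 0 < k ∧ m ^ (k + 1 + i) = m ^ (1 + i) := by
    obtain ⟨i, j, hne, h⟩ := Finite.exists_ne_map_eq_of_infinite fun i : ℕ => m ^ (1 + i)
    rcases hne.lt_or_gt with hlt | hlt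
    · exact ⟨i, j - i, by omega, by rw [show j - i + 1 + i = 1 + j by omega]; exact h.symm⟩
    · exact ⟨j, i - j, by omega, by rw [show i - j + 1 + j = 1 + i by omega]; exact h⟩
  refine ⟨k, hk, ?_⟩
  have hcancel : ∀ n : ℕ, m ^ (n + 1 + 1) * m' = m ^ (n + 1) := by
    intro n
    rw [pow_succ, mul_assoc, hmm', pow_succ, mul_assoc, (hid m hmH).2]
  induction i with
  | zero => simpa using hik
  | succ i ih =>
    apply ih
    have h := congrArg (· * m') hik
    rwa [show k + 1 + (i + 1) = k + i + 1 + 1 by omega, show 1 + (i + 1) = i + 1 + 1 by omega,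
      hcancel, hcancel, show k + i + 1 = k + 1 + i by omega, add_comm i 1] at h

theorem memSubgroup_of_pow_succ_eq {M : Type*} [Monoid M] {m : M} {k : ℕ} (hk : 0 < k)
    (hm : m ^ (k + 1) = m) : MemSubgroup m := by
  refine ⟨⟨{y | ∃ n, 0 < n ∧ m ^ n = y}, ?_⟩, ⟨1, one_pos, pow_one m⟩, m ^ k, ⟨k, hk, rfl⟩, ?_, ?_⟩
  · rintro _ _ ⟨i, hi, rfl⟩ ⟨j, hj, rfl⟩
    exact ⟨i + j, by omega, pow_add m i j⟩
  · rintro _ ⟨n, hn, rfl⟩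
    obtain ⟨p, rfl⟩ := Nat.exists_eq_succ_of_ne_zero hn.ne'
    have h : m ^ (k + (p + 1)) = m ^ (p + 1) := by
      rw [show k + (p + 1) = k + 1 + p by omega, pow_add, hm, ← pow_succ']
    exact ⟨by rw [← pow_add, h], by rw [← pow_add, add_comm, h]⟩
  · rintro _ ⟨n, hn, rfl⟩
    have hpos : 0 < n * (2 * k - 1) := mul_pos hn (by omega)
    have hsum : n + n * (2 * k - 1) = k * (2 * n) := by
      obtain ⟨l, rfl⟩ := Nat.exists_eq_succ_of_ne_zero hk.ne'
      rw [show 2 * l.succ - 1 = 2 * l + 1 by omega, Nat.succ_eq_add_one]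
      ring
    refine ⟨m ^ (n * (2 * k - 1)), ⟨_, hpos, rfl⟩, ?_, ?_⟩
    · rw [← pow_add, hsum, pow_mul_eq_of_pow_succ_eq hk hm (by omega)]
    · rw [← pow_add, add_comm, hsum, pow_mul_eq_of_pow_succ_eq hk hm (by omega)]

theorem SSSPreserving.exists_pow_succ_eq {M : Type*} [Monoid M]
    (h : SSSPreserving M) (m : M) : ∃ k, 0 < k ∧ m ^ (k + 1) = m := by
  by_contra! hm
  let S := Multiplicative (ULift ℕ →₀ ZMod 2)
  have hsq : ∀ x : S, x * x = 1 := fun x => by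
    change x.toAdd + x.toAdd = 0
    rw [← two_smul (ZMod 2), show (2 : ZMod 2) = 0 from rfl, zero_smul]
  let U : Subsemigroup (S × M) :=
    { carrier := {u | (u.1 ≠ 1 ∧ u.2 = m) ∨ ∃ i, 2 ≤ i ∧ u.2 = m ^ i}
      mul_mem' := by
        have key : ∀ u : S × M, ((u.1 ≠ 1 ∧ u.2 = m) ∨ ∃ i, 2 ≤ i ∧ u.2 = m ^ i) →
            ∃ i, 1 ≤ i ∧ u.2 = m ^ i := by
          rintro u (⟨-, h⟩ | ⟨i, hi, h⟩)
          · exact ⟨1, le_rfl, by rw [h, pow_one]⟩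
          · exact ⟨i, by omega, h⟩
        intro a b ha hb
        obtain ⟨i, hi, hai⟩ := key a ha
        obtain ⟨j, hj, hbj⟩ := key b hb
        exact .inr ⟨i + j, by omega, by rw [Prod.snd_mul, hai, hbj, pow_add]⟩ }
  have hU : ((1 : S), m) ∉ U := by
    rintro (⟨h, -⟩ | ⟨i, hi, h⟩)
    · exact h rfl
    · exact hm (i - 1) (by omega) (by rw [Nat.sub_add_cancel (by omega)]; exact h.symm)
  obtain ⟨P, hP, hf, φ, hφ⟩ :=
    h S (isSSS_multiplicative_of_module_zmod_two _) (1, m) U hU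
  have : Infinite S := inferInstanceAs (Infinite (ULift ℕ →₀ ZMod 2))
  obtain ⟨x, y, hne, hxy⟩ := Finite.exists_ne_map_eq_of_infinite fun x : S => φ (x, 1)
  refine hφ ⟨(y * x, m), .inl ⟨fun h1 => hne ?_, rfl⟩, ?_⟩
  · have h2 : y * x = x * x := h1.trans (hsq x).symm
    exact (mul_right_cancel h2).symm
  · have h1 : ((y * x, m) : S × M) = (y, 1) * (x, m) := by simp
    have h2 : ((1, m) : S × M) = (x, 1) * (x, m) := by simp [hsq]
    rw [h1, h2, map_mul, map_mul]
    exact congrArg (· * φ (x, m)) hxy.symm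

theorem sssPreserving_of_pow_succ_eq {M : Type*} [Monoid M] [Finite M]
    (h : ∀ m : M, ∃ k, 0 < k ∧ m ^ (k + 1) = m) : SSSPreserving M := by
  intro S _ hS
  rintro ⟨s, m⟩ U hs
  obtain ⟨k, hk, hm⟩ := h m
  let ι : S × M →ₙ* WithOne S × M := WithOne.coeMulHom.prodMap (MulHom.id M)
  have hι : Function.Injective ι := by
    rintro ⟨a, b⟩ ⟨c, d⟩ hac
    have h : ((a : WithOne S), b) = ((c : WithOne S), d) := hac
    exact Prod.ext (WithOne.coe_injective (Prod.ext_iff.1 h).1) (Prod.ext_iff.1 h).2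
  have hsU : ι (s, m) ∉ U.map ι := by
    rintro ⟨u, hu, hus⟩
    exact hs (hι hus ▸ hu)
  obtain ⟨P, hP, hf, φ, hφ⟩ := hS.withOne.separates_fiber hk hm (U.map ι) hsU
  refine (Separates.comap ι (Y := (U.map ι : Set (WithOne S × M))) ?_).mono_s8
    fun u hu => Subsemigroup.mem_map_of_mem ι hu
  refine separates_of_mulHom (φ.prodMap (MulHom.id M)) ?_
  rintro ⟨⟨x, n⟩, hx, hxs⟩
  obtain rfl : n = m := congrArg Prod.snd hxs
  exact hφ ⟨x, hx, congrArg Prod.fst hxs⟩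

/-- A finite monoid is strong-subsemigroup-separability preserving iff it is a
union of groups. -/
theorem stmt_8 (M : Type*) [Monoid M] [Finite M] :
    SSSPreserving M ↔ ∀ m : M, MemSubgroup m := by
  refine ⟨fun h m => ?_, fun h => sssPreserving_of_pow_succ_eq fun m => (h m).exists_pow_succ_eq⟩
  obtain ⟨k, hk, hm⟩ := h.exists_pow_succ_eq m
  exact memSubgroup_of_pow_succ_eq hk hm
end

section
/- The direct product ℕ × ℤ, where ℕ is the semigroup of positive integers under addition and ℤ is the group of integers under addition, is weakly subsemigroup separable. -/
theorem ZMod.two_pow_eq_two_pow_iff {k n : ℕ} :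
    (2 : ZMod (2 ^ (n + 1))) ^ k = 2 ^ n ↔ k = n := by
  refine ⟨fun h => ?_, fun h => by rw [h]⟩
  have h' : 2 ^ k ≡ 2 ^ n [MOD 2 ^ (n + 1)] := by
    rw [← ZMod.natCast_eq_natCast_iff]
    push_cast
    exact h
  have hn : 2 ^ n < 2 ^ (n + 1) := Nat.pow_lt_pow_right one_lt_two n.lt_succ_self
  rcases Nat.lt_or_ge k (n + 1) with hk | hk
  · exact Nat.pow_right_injective le_rfl
      (h'.eq_of_lt_of_lt (Nat.pow_lt_pow_right one_lt_two hk) hn)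
  · have hdvd : 2 ^ (n + 1) ∣ 2 ^ n := (h'.dvd_iff dvd_rfl).1 (pow_dvd_pow 2 hk)
    exact absurd (Nat.le_of_dvd (by positivity) hdvd) hn.not_ge

/-- The second coordinates in a finitely generated subsemigroup of `ℕ × ℤ` are bounded linearly
in the first ones. -/
theorem exists_abs_snd_le_mul_fst_of_mem_closure
    (X : Finset (Multiplicative ℕ+ × Multiplicative ℤ)) :
    ∃ C : ℕ, ∀ t ∈ Subsemigroup.closure (X : Set (Multiplicative ℕ+ × Multiplicative ℤ)),
      |t.2.toAdd| ≤ (C : ℤ) * (t.1.toAdd : ℕ) := by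
  refine ⟨X.sup fun x => x.2.toAdd.natAbs, fun t ht => ?_⟩
  induction ht using Subsemigroup.closure_induction with
  | mem x hx =>
    have hC : x.2.toAdd.natAbs ≤ X.sup fun x => x.2.toAdd.natAbs :=
      Finset.le_sup (f := fun x : Multiplicative ℕ+ × Multiplicative ℤ => x.2.toAdd.natAbs) hx
    rw [Int.abs_eq_natAbs]
    exact_mod_cast hC.trans (Nat.le_mul_of_pos_right _ x.1.toAdd.pos)
  | mul x y _ _ hx hy =>
    simp only [Prod.fst_mul, Prod.snd_mul, toAdd_mul, PNat.add_coe, Nat.cast_add, mul_add]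
    exact (abs_add_le _ _).trans (add_le_add hx hy)

/-- The homomorphism from `ℕ × ℤ` sending `(k, z)` to `(2 ^ k, z)` modulo `r` and `m`. -/
def twoPowProdCast (r m : ℕ) :
    Multiplicative ℕ+ × Multiplicative ℤ →ₙ* ZMod r × Multiplicative (ZMod m) where
  toFun t := (2 ^ (t.1.toAdd : ℕ), Multiplicative.ofAdd (t.2.toAdd : ZMod m))
  map_mul' x y := by simp [pow_add]

/-- `ℕ × ℤ` is weakly subsemigroup separable. -/
theorem stmt_9 : IsWSS (Multiplicative ℕ+ × Multiplicative ℤ) := by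
  intro s X hs
  obtain ⟨C, hC⟩ := exists_abs_snd_le_mul_fst_of_mem_closure X
  let n : ℕ := s.1.toAdd
  let m : ℕ := C * n + s.2.toAdd.natAbs + 1
  have : NeZero m := ⟨Nat.succ_ne_zero _⟩
  refine ⟨ZMod (2 ^ (n + 1)) × Multiplicative (ZMod m), inferInstance,
    inferInstanceAs (Finite (ZMod (2 ^ (n + 1)) × ZMod m)), twoPowProdCast _ _, ?_⟩
  rintro ⟨t, ht, hts⟩
  have hfst : (t.1.toAdd : ℕ) = n := ZMod.two_pow_eq_two_pow_iff.1 (congrArg Prod.fst hts)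
  have hsnd : (t.2.toAdd : ZMod m) = s.2.toAdd :=
    Multiplicative.ofAdd.injective (congrArg Prod.snd hts)
  have hdvd : (m : ℤ) ∣ t.2.toAdd - s.2.toAdd :=
    (ZMod.intCast_eq_intCast_iff_dvd_sub _ _ _).1 hsnd.symm
  have hlt : |t.2.toAdd - s.2.toAdd| < m := by
    have h := hC t ht
    rw [hfst] at h
    have := abs_sub t.2.toAdd s.2.toAdd
    simp only [m]
    push_cast
    linarith
  have heq : t.2.toAdd = s.2.toAdd := sub_eq_zero.1 (Int.eq_zero_of_abs_lt_dvd hdvd hlt)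
  have hts' : t = s := Prod.ext (Multiplicative.toAdd.injective (PNat.coe_injective hfst))
    (Multiplicative.toAdd.injective heq)
  exact hs (hts' ▸ ht)
end

section
/- The additive group ℤ of integers, regarded as a semigroup, is not monogenic subsemigroup separable: there exist an element of ℤ and a subsemigroup of ℤ generated by a single element and not containing that element, such that every semigroup homomorphism from ℤ to a finite semigroup maps the element into the image of the subsemigroup. -/
theorem toAdd_pos_of_mem_closure_ofAdd_one :
    ∀ y ∈ Subsemigroup.closure {Multiplicative.ofAdd (1 : ℤ)}, 0 < y.toAdd := by
  intro y hy
  induction hy using Subsemigroup.closure_induction with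
  | mem y hy => rw [Set.mem_singleton_iff.1 hy]; exact Int.one_pos
  | mul a b _ _ ha hb => rw [toAdd_mul]; exact add_pos ha hb

theorem ofAdd_natCast_succ_mem_closure (n : ℕ) :
    Multiplicative.ofAdd ((n : ℤ) + 1) ∈
      Subsemigroup.closure {Multiplicative.ofAdd (1 : ℤ)} := by
  induction n with
  | zero => exact Subsemigroup.subset_closure (by simp)
  | succ n ih =>
    rw [ofAdd_add, Nat.cast_succ]
    exact mul_mem ih (Subsemigroup.subset_closure rfl)

/-- `ℤ` (under addition) is not monogenic subsemigroup separable: there are an element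
and a monogenic subsemigroup avoiding it which cannot be separated by any homomorphism
to a finite semigroup. -/
theorem stmt_10 : ∃ (s x : Multiplicative ℤ),
    s ∉ Subsemigroup.closure {x} ∧
    ∀ (P : Type) [Semigroup P] [Finite P] (φ : Multiplicative ℤ →ₙ* P),
      φ s ∈ φ '' (Subsemigroup.closure {x} : Set (Multiplicative ℤ)) := by
  refine ⟨1, Multiplicative.ofAdd 1,
    fun h => lt_irrefl _ (toAdd_pos_of_mem_closure_ofAdd_one 1 h), ?_⟩
  intro P _ _ φ
  obtain ⟨m, n, hmn, h⟩ : ∃ m n : ℕ, m < n ∧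
      φ (Multiplicative.ofAdd (m : ℤ)) = φ (Multiplicative.ofAdd (n : ℤ)) := by
    obtain ⟨m, n, hne, h⟩ :=
      Finite.exists_ne_map_eq_of_infinite fun k : ℕ => φ (Multiplicative.ofAdd (k : ℤ))
    rcases hne.lt_or_gt with hlt | hlt
    · exact ⟨m, n, hlt, h⟩
    · exact ⟨n, m, hlt, h.symm⟩
  obtain ⟨k, rfl⟩ := Nat.exists_eq_add_of_lt hmn
  refine ⟨_, ofAdd_natCast_succ_mem_closure k, ?_⟩
  calc φ (Multiplicative.ofAdd ((k : ℤ) + 1))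
      = φ (Multiplicative.ofAdd ((m + k + 1 : ℕ) : ℤ) * Multiplicative.ofAdd (-m : ℤ)) := by
        rw [← ofAdd_add]; congr 2; push_cast; ring
    _ = φ (Multiplicative.ofAdd (m : ℤ) * Multiplicative.ofAdd (-m : ℤ)) := by
        rw [map_mul, ← h, ← map_mul]
    _ = φ 1 := by rw [← ofAdd_add, add_neg_cancel, ofAdd_zero]
end

section
/- Let S be the semigroup whose underlying set is FC₂ ⊔ {x_z : z ∈ ℤ} ⊔ {0}, where FC₂ is the free commutative semigroup on {a, b}, with multiplication extending that of FC₂ by: x_z · x_{z'} = x_z · 0 = 0 · x_z = 0 · 0 = 0; x_z · w = x_{z+φ(w)} and w · x_z = x_{z−φ(w)} for w ∈ FC₂, where φ(a^i b^j) = i − j; and 0 · w = w · 0 = 0 for w ∈ FC₂. Let L be a left-zero semigroup with at least two elements (xy = x for all x, y ∈ L). Then the direct product S × L is not weakly subsemigroup separable. -/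
/-- The carrier of the semigroup `S[FC₂, ℤ, φ]`: the free commutative semigroup
`FC₂` on `{a, b}` (an element `fc i j _` represents `aⁱbʲ` with `i + j ≠ 0`),
together with a null semigroup `{x_z : z ∈ ℤ} ∪ {0}`. -/
inductive SC : Type
  | fc : (i j : ℕ) → i + j ≠ 0 → SC
  | xz : ℤ → SC
  | zero : SC

namespace SC

/-- Multiplication on `SC`: `FC₂` multiplies as the free commutative semigroup
(`aⁱbʲ ⬝ aᵏbˡ = a^(i+k) b^(j+l)`), `x_z ⬝ w = x_{z + φ w}` and `w ⬝ x_z = x_{z - φ w}`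
for `w ∈ FC₂`, where `φ (aⁱbʲ) = i - j`, and all other products are `0`. -/
def mul : SC → SC → SC
  | fc i j h, fc k l h' => fc (i + k) (j + l) (by omega)
  | fc i j _, xz z => xz (z - ((i : ℤ) - (j : ℤ)))
  | xz z, fc i j _ => xz (z + ((i : ℤ) - (j : ℤ)))
  | xz _, xz _ => zero
  | zero, _ => zero
  | _, zero => zero

instance : Mul SC := ⟨mul⟩

theorem fc_eq {i j k l : ℕ} (h : i + j ≠ 0) (h' : k + l ≠ 0) (hi : i = k) (hj : j = l) :
    fc i j h = fc k l h' := by subst hi; subst hj; rfl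

instance : Semigroup SC where
  mul_assoc := by
    rintro (⟨i, j, hij⟩ | z | _) (⟨k, l, hkl⟩ | w | _) (⟨m, n, hmn⟩ | v | _) <;>
      show mul (mul _ _) _ = mul _ (mul _ _) <;>
      simp only [mul] <;>
      first
        | rfl
        | (apply fc_eq <;> omega)
        | (apply congrArg; push_cast; ring)

end SC

/-- A subsemigroup containing `(a, m)` and `(x₀, l)` in which every `(x_z, l)` has `0 ≤ z`. -/
def SC.nonnegAt {L : Type*} [Semigroup L] (hL : ∀ x y : L, x * y = x) (l m : L) (hlm : l ≠ m) :
    Subsemigroup (SC × L) where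
  carrier := {p | match p with
    | (SC.fc _ j _, k) => j = 0 ∧ k = m
    | (SC.xz z, k) => k = l → 0 ≤ z
    | (SC.zero, _) => True}
  mul_mem' := by
    rintro ⟨⟨i, j, hij⟩ | z | _, k⟩ ⟨⟨i', j', hij'⟩ | z' | _, k'⟩ h h'
    · exact ⟨by rw [h.1, h'.1], (hL k k').trans h.2⟩
    · exact fun hk => absurd (hk.symm.trans ((hL k k').trans h.2)) hlm
    · trivial
    · intro hk
      have hz : 0 ≤ z := h ((hL k k').symm.trans hk)
      have hj : j' = 0 := h'.1
      change 0 ≤ z + ((i' : ℤ) - (j' : ℤ))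
      omega
    all_goals trivial

theorem SC.xz_mul_fc_zero {L : Type*} [Semigroup L] (hL : ∀ x y : L, x * y = x)
    (l k : L) (z : ℤ) (n : ℕ) (hn : n + 0 ≠ 0) :
    ((SC.xz z, l) : SC × L) * (SC.fc n 0 hn, k) = (SC.xz (z + n), l) := by
  refine Prod.ext ?_ (hL l k)
  change SC.xz (z + ((n : ℤ) - ((0 : ℕ) : ℤ))) = SC.xz (z + n)
  simp

/-- The direct product of the semigroup `S[FC₂, ℤ, φ]` with a non-trivial left-zero
semigroup is not weakly subsemigroup separable. -/
theorem stmt_11 (L : Type*) [Semigroup L] (hL : ∀ x y : L, x * y = x)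
    (hnt : ∃ x y : L, x ≠ y) : ¬ IsWSS (SC × L) := by
  classical
  obtain ⟨l, m, hlm⟩ := hnt
  intro hS
  let X : Finset (SC × L) := {(SC.fc 1 0 one_ne_zero, m), (SC.xz 0, l)}
  have hle : Subsemigroup.closure (X : Set (SC × L)) ≤ SC.nonnegAt hL l m hlm := by
    rw [Subsemigroup.closure_le]
    intro p hp
    rcases Finset.mem_insert.1 (Finset.mem_coe.1 hp) with rfl | hp
    · exact ⟨rfl, rfl⟩
    · rw [Finset.mem_singleton.1 hp]
      exact fun _ => le_rfl
  have hnot : ((SC.xz (-1), l) : SC × L) ∉ Subsemigroup.closure (X : Set (SC × L)) := by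
    intro h
    have h' : l = l → (0 : ℤ) ≤ -1 := hle h
    exact absurd (h' rfl) (by decide)
  have hmem (n : ℕ) : ((SC.xz n, l) : SC × L) ∈ Subsemigroup.closure (X : Set (SC × L)) := by
    induction n with
    | zero => exact Subsemigroup.subset_closure (by simp [X])
    | succ n ih =>
      have h := mul_mem ih (Subsemigroup.subset_closure
        (show ((SC.fc 1 0 one_ne_zero, m) : SC × L) ∈ (X : Set (SC × L)) by simp [X]))
      rw [SC.xz_mul_fc_zero hL] at h
      exact_mod_cast h
  obtain ⟨P, _, _, φ, hφ⟩ := hS _ X hnot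
  obtain ⟨i, j, hij, heq⟩ : ∃ i j : ℕ, i < j ∧
      φ (SC.fc (i + 1) 0 (by omega), l) = φ (SC.fc (j + 1) 0 (by omega), l) := by
    obtain ⟨i, j, hne, heq⟩ := Finite.exists_ne_map_eq_of_infinite
      (fun n : ℕ => φ (SC.fc (n + 1) 0 (by omega), l))
    rcases hne.lt_or_gt with h | h
    · exact ⟨i, j, h, heq⟩
    · exact ⟨j, i, h, heq.symm⟩
  refine hφ ⟨_, hmem (j - i - 1), ?_⟩
  have h := congrArg (φ (SC.xz (-2 - i), l) * ·) heq
  simp only [← map_mul, SC.xz_mul_fc_zero hL] at h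
  convert h.symm using 4 <;> omega
end

section
/- Let A be the semigroup defined by the presentation ⟨a, b, c | ab²c = b⟩, i.e. the quotient of the free semigroup on three generators a, b, c by the smallest congruence identifying ab²c with b. The semigroup homomorphism φ from A to the free group F₂ on generators x, y determined by a ↦ x, b ↦ y, c ↦ y⁻²x⁻¹y is injective. -/
abbrev FS3 := FreeSemigroup (Fin 3)

/-- The defining relation `ab²c = b` of the presentation `⟨a,b,c ∣ ab²c = b⟩`,
where `a`, `b`, `c` are the three free generators. -/
def relA : FS3 → FS3 → Prop := fun u v =>
  u = FreeSemigroup.of 0 * FreeSemigroup.of 1 * FreeSemigroup.of 1 * FreeSemigroup.of 2 ∧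
    v = FreeSemigroup.of 1

/-- The congruence on the free semigroup generated by the pair `(ab²c, b)`. -/
def conA : Con FS3 := conGen relA

/-- The semigroup `A = ⟨a,b,c ∣ ab²c = b⟩`. -/
abbrev A : Type := conA.Quotient

/-- The image of the generator `a` in `A`. -/
def aA : A := ((FreeSemigroup.of 0 : FS3) : A)

/-- The image of the generator `b` in `A`. -/
def bA : A := ((FreeSemigroup.of 1 : FS3) : A)

/-- The image of the generator `c` in `A`. -/
def cA : A := ((FreeSemigroup.of 2 : FS3) : A)

/-- The free group `F₂` on two generators. -/
abbrev F2 := FreeGroup (Fin 2)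

/-- The generator `x` of `F₂`. -/
def xg : F2 := FreeGroup.of 0

/-- The generator `y` of `F₂`. -/
def yg : F2 := FreeGroup.of 1

/-- The homomorphism `A → F₂` with `a ↦ x`, `b ↦ y`, `c ↦ y⁻²x⁻¹y`. -/
def toFreeGroup : A →ₙ* F2 where
  toFun p := p.liftOn (FreeSemigroup.lift ![xg, yg, yg⁻¹ * yg⁻¹ * xg⁻¹ * yg]) <| by
    refine Con.conGen_le (c := Con.ker _).2 ?_
    rintro _ _ ⟨rfl, rfl⟩
    simp [Con.ker_rel, mul_assoc]
  map_mul' p q := Con.induction_on₂ p q fun u v => map_mul _ u v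

/-- A generator of the presentation, as an element of `A` with an identity adjoined. -/
def gen (i : Fin 3) : WithOne A := (((FreeSemigroup.of i : FS3) : A) : WithOne A)

/-- Writing `tᵢ = yⁱxy⁻ⁱ`, the image of a word in `F₂`, conjugated by `yʰ`, is a product of
letters `tᵢ^±1` followed by a power of `y`. This is the list of those letters. -/
def emit : ℤ → List (Fin 3) → List (ℤ × Bool)
  | _, [] => []
  | h, 0 :: w => (h, true) :: emit h w
  | h, 1 :: w => emit (h + 1) w
  | h, 2 :: w => (h - 2, false) :: emit (h - 1) w

/-- The height reached after reading a word from height `h`: `a` is level, `b` goes up by one and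
`c` goes down by one. -/
def endHeight : ℤ → List (Fin 3) → ℤ
  | h, [] => h
  | h, 0 :: w => endHeight h w
  | h, 1 :: w => endHeight (h + 1) w
  | h, 2 :: w => endHeight (h - 1) w

/-- The right action of `F₂` on `ℤ × FreeGroup ℤ`, where `y` raises the height and `x` appends
the letter indexed by the current height. -/
def heightAction : F2 →* (Equiv.Perm (ℤ × FreeGroup ℤ))ᵐᵒᵖ :=
  FreeGroup.lift ![
    MulOpposite.op
      { toFun := fun p => (p.1, p.2 * FreeGroup.of p.1)
        invFun := fun p => (p.1, p.2 * (FreeGroup.of p.1)⁻¹)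
        left_inv := fun p => by simp
        right_inv := fun p => by simp },
    MulOpposite.op
      { toFun := fun p => (p.1 + 1, p.2)
        invFun := fun p => (p.1 - 1, p.2)
        left_inv := fun p => by simp
        right_inv := fun p => by simp }]

theorem le_of_emit_eq_cons {w : List (Fin 3)} {h i : ℤ} {s : Bool} {l : List (ℤ × Bool)}
    (hw : emit h w = (i, s) :: l) : if s then h ≤ i else h - 2 ≤ i := by
  induction w generalizing h with
  | nil => simp [emit] at hw
  | cons j w ih =>
    fin_cases j
    · simp only [emit, List.cons.injEq, Prod.mk.injEq] at hw
      simp [← hw.1.1, ← hw.1.2]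
    · have := ih (h := h + 1) (by simpa [emit] using hw)
      cases s <;> simp at this ⊢ <;> omega
    · simp only [emit, List.cons.injEq, Prod.mk.injEq] at hw
      simp [← hw.1.1, ← hw.1.2]

theorem le_endHeight_of_emit_eq_nil {w : List (Fin 3)} {h : ℤ} (hw : emit h w = []) :
    h ≤ endHeight h w := by
  induction w generalizing h with
  | nil => simp [endHeight]
  | cons j w ih =>
    fin_cases j
    · simp [emit] at hw
    · have := ih (h := h + 1) (by simpa [emit] using hw)
      simp only [endHeight]
      omega
    · simp [emit] at hw

/-- A word is determined by its letters and its final height. -/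
theorem eq_of_emit_eq {u v : List (Fin 3)} {h : ℤ} (he : emit h u = emit h v)
    (hh : endHeight h u = endHeight h v) : u = v := by
  have up_ne (w v : List (Fin 3)) (h : ℤ) (hv : ∀ v', v ≠ 1 :: v')
      (he : emit (h + 1) w = emit h v) (hh : endHeight (h + 1) w = endHeight h v) : False := by
    rcases v with _ | ⟨j, v⟩
    · have := le_endHeight_of_emit_eq_nil he
      simp only [endHeight] at hh this
      omega
    · fin_cases j
      · have := le_of_emit_eq_cons he
        simp at this
      · exact hv v rfl
      · have := le_of_emit_eq_cons he
        simp at this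
  induction u generalizing h v with
  | nil =>
    rcases v with _ | ⟨j, v⟩
    · rfl
    · fin_cases j
      · simp [emit] at he
      · exact (up_ne v [] h (by simp) he.symm hh.symm).elim
      · simp [emit] at he
  | cons i u ih =>
    rcases v with _ | ⟨j, v⟩
    · fin_cases i
      · simp [emit] at he
      · exact (up_ne u [] h (by simp) he hh).elim
      · simp [emit] at he
    · fin_cases i <;> fin_cases j
      · exact congrArg _ (ih (by simpa [emit] using he) hh)
      · exact (up_ne v _ h (by simp) he.symm hh.symm).elim
      · simp [emit] at he
      · exact (up_ne u _ h (by simp) he hh).elim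
      · exact congrArg _ (ih he hh)
      · exact (up_ne u _ h (by simp) he hh).elim
      · simp [emit] at he
      · exact (up_ne v _ h (by simp) he.symm hh.symm).elim
      · exact congrArg _ (ih (by simpa [emit] using he) hh)

/-- The only way to cancel a letter emitted by `a` is to continue with `b²c`. -/
theorem exists_of_emit_eq_cons_self {w : List (Fin 3)} {h : ℤ} {l : List (ℤ × Bool)}
    (hw : emit h w = (h, false) :: l) : ∃ w', w = 1 :: 1 :: 2 :: w' := by
  rcases w with _ | ⟨i, w⟩
  · simp [emit] at hw
  fin_cases i <;> simp [emit] at hw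
  rcases w with _ | ⟨i, w⟩
  · simp [emit] at hw
  fin_cases i <;> simp [emit] at hw
  · rcases w with _ | ⟨i, w⟩
    · simp [emit] at hw
    fin_cases i <;> simp [emit] at hw
    · have := le_of_emit_eq_cons hw
      simp at this
      omega
    · exact ⟨w, rfl⟩
  · omega

theorem gen_relation : gen 0 * (gen 1 * (gen 1 * gen 2)) = gen 1 := by
  simp only [gen, ← WithOne.coe_mul, ← Con.coe_mul]
  refine congrArg _ ((Con.eq conA).2 (ConGen.Rel.of _ _ ⟨?_, rfl⟩))
  simp only [mul_assoc]

theorem exists_normal_gen_mul (i : Fin 3) {w : List (Fin 3)}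
    (hw : ∀ h, FreeGroup.IsReduced (emit h w)) :
    ∃ w', (∀ h, FreeGroup.IsReduced (emit h w')) ∧
      gen i * (w.map gen).prod = (w'.map gen).prod := by
  fin_cases i
  · by_cases H : ∃ h l, emit h w = (h, false) :: l
    · obtain ⟨h, l, hl⟩ := H
      obtain ⟨w, rfl⟩ := exists_of_emit_eq_cons_self hl
      refine ⟨1 :: w, fun h => ?_, ?_⟩
      · have := hw h
        simp only [emit] at this ⊢
        rw [show h + 1 + 1 - 1 = h + 1 by ring] at this
        exact List.IsChain.tail this
      · simp only [List.map_cons, List.prod_cons, Fin.zero_eta]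
        nth_rw 3 [← gen_relation]
        simp only [mul_assoc]
    · refine ⟨0 :: w, fun h => ?_, by simp⟩
      simp only [emit]
      refine List.isChain_cons.2 ⟨?_, hw h⟩
      rintro ⟨j, s⟩ hj hs
      obtain ⟨l, hl⟩ := List.head?_eq_some_iff.1 hj
      cases s
      · exact (H ⟨h, l, by rw [hl]; simp_all⟩).elim
      · rfl
  · exact ⟨1 :: w, fun h => hw (h + 1), by simp⟩
  · refine ⟨2 :: w, fun h => ?_, by simp⟩
    simp only [emit]
    refine List.isChain_cons.2 ⟨?_, hw (h - 1)⟩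
    rintro ⟨j, s⟩ hj hs
    obtain ⟨l, hl⟩ := List.head?_eq_some_iff.1 hj
    have := le_of_emit_eq_cons hl
    cases s
    · rfl
    · simp at this hs
      omega

theorem exists_normal (p : A) :
    ∃ w, (∀ h, FreeGroup.IsReduced (emit h w)) ∧ (p : WithOne A) = (w.map gen).prod := by
  induction p using Con.induction_on with | _ u
  induction u using FreeSemigroup.recOnMul with
  | ih1 i =>
    obtain ⟨w, hw, e⟩ := exists_normal_gen_mul i (w := []) (by simp [emit])
    exact ⟨w, hw, by simpa [gen] using e⟩
  | ih2 i u _ ih =>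
    obtain ⟨w, hw, e⟩ := ih
    obtain ⟨w', hw', e'⟩ := exists_normal_gen_mul i hw
    refine ⟨w', hw', ?_⟩
    rw [← e', ← e, Con.coe_mul, WithOne.coe_mul, gen]

theorem heightAction_prod (w : List (Fin 3)) (h : ℤ) (g : FreeGroup ℤ) :
    (heightAction (WithOne.lift toFreeGroup (w.map gen).prod)).unop (h, g) =
      (endHeight h w, g * FreeGroup.mk (emit h w)) := by
  induction w generalizing h g with
  | nil => simp [emit, endHeight, ← FreeGroup.one_eq_mk]
  | cons i w ih =>
    have hi : (heightAction (WithOne.lift toFreeGroup (gen i))).unop (h, g) =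
        (endHeight h [i], g * FreeGroup.mk (emit h [i])) := by
      change (heightAction (![xg, yg, yg⁻¹ * yg⁻¹ * xg⁻¹ * yg] i)).unop (h, g) = _
      fin_cases i
      · simp [emit, endHeight, heightAction, xg, FreeGroup.of]
      · simp [emit, endHeight, heightAction, yg, ← FreeGroup.one_eq_mk]
      · have hf : (FreeGroup.mk [(h - 2, false)] : FreeGroup ℤ) = (FreeGroup.of (h - 2))⁻¹ := rfl
        have h2 : h - 1 - 1 = h - 2 := by ring
        have h1 : h - 2 + 1 = h - 1 := by ring
        simp [emit, endHeight, heightAction, xg, yg, Equiv.Perm.inv_def, Equiv.symm, hf, h1, h2]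
    rw [List.map_cons, List.prod_cons, map_mul, map_mul, MulOpposite.unop_mul,
      Equiv.Perm.mul_apply, hi, ih, mul_assoc, FreeGroup.mul_mk]
    fin_cases i <;> rfl

/-- The semigroup homomorphism `A → F₂` determined by `a ↦ x`, `b ↦ y`,
`c ↦ y⁻²x⁻¹y` exists and is injective. -/
theorem stmt_14 : ∃ φ : A →ₙ* F2,
    φ aA = xg ∧ φ bA = yg ∧ φ cA = yg⁻¹ * yg⁻¹ * xg⁻¹ * yg ∧
    Function.Injective φ := by
  refine ⟨toFreeGroup, rfl, rfl, rfl, fun p q hpq => ?_⟩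
  obtain ⟨u, hu, hpu⟩ := exists_normal p
  obtain ⟨v, hv, hqv⟩ := exists_normal q
  have key : WithOne.lift toFreeGroup (u.map gen).prod =
      WithOne.lift toFreeGroup (v.map gen).prod := by
    rw [← hpu, ← hqv, WithOne.lift_coe, WithOne.lift_coe, hpq]
  have act := heightAction_prod u 0 1
  rw [key, heightAction_prod, Prod.mk.injEq, one_mul, one_mul] at act
  have he : emit 0 u = emit 0 v := by
    rw [← (hu 0).reduce_eq, ← (hv 0).reduce_eq]
    exact FreeGroup.reduce.sound act.2.symm
  rw [← WithOne.coe_inj, hpu, hqv, eq_of_emit_eq he act.1.symm]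
end

section
/- Let A be the semigroup defined by the presentation ⟨a, b, c | ab²c = b⟩, and let φ : A → F₂ be the semigroup homomorphism to the free group on generators x, y determined by a ↦ x, b ↦ y, c ↦ y⁻²x⁻¹y. Then φ(w) is not the identity element of F₂ for any w ∈ A. -/
/-- The map from the free semigroup to `F₂` given by `a ↦ x`, `b ↦ y`, `c ↦ y⁻²x⁻¹y`. -/
def freeToF2 : FS3 →ₙ* F2 := FreeSemigroup.lift ![xg, yg, yg⁻¹ * yg⁻¹ * xg⁻¹ * yg]

theorem freeToF2_of (i : Fin 3) :
    freeToF2 (FreeSemigroup.of i) = ![xg, yg, yg⁻¹ * yg⁻¹ * xg⁻¹ * yg] i :=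
  FreeSemigroup.lift_of _ i

theorem conA_le_ker_freeToF2 : conA ≤ Con.ker freeToF2 := by
  refine Con.conGen_le.2 ?_
  rintro _ _ ⟨rfl, rfl⟩
  simp [Con.ker_rel, freeToF2_of, mul_assoc]

/-- The homomorphism `A → F₂` induced by `freeToF2`. -/
def toF2 : A →ₙ* F2 where
  toFun w := Con.liftOn w freeToF2 fun _ _ h => conA_le_ker_freeToF2 h
  map_mul' u v := Con.induction_on₂ u v fun u v => map_mul freeToF2 u v

/-- The affine action of `F₂` on `ℚ` in which `x` acts by `t ↦ (t + 1) / 4` and `y` by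
`t ↦ t + 1`; then `y⁻²x⁻¹y` acts by `t ↦ 4t + 1`. -/
def affineAction : F2 →* Equiv.Perm ℚ :=
  FreeGroup.lift ![(Equiv.addRight 1).trans (Equiv.divRight₀ 4 four_ne_zero), Equiv.addRight 1]

theorem affineAction_xg_apply (t : ℚ) : affineAction xg t = (t + 1) / 4 := by
  simp [affineAction, xg]

theorem affineAction_yg_apply (t : ℚ) : affineAction yg t = t + 1 := by
  simp [affineAction, yg]

theorem affineAction_xg_inv_apply (t : ℚ) : affineAction xg⁻¹ t = 4 * t - 1 := by
  rw [map_inv, Equiv.Perm.inv_eq_iff_eq, affineAction_xg_apply]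
  ring

theorem affineAction_yg_inv_apply (t : ℚ) : affineAction yg⁻¹ t = t - 1 := by
  rw [map_inv, Equiv.Perm.inv_eq_iff_eq, affineAction_yg_apply]
  ring

theorem affineAction_freeToF2_of_pos (i : Fin 3) {t : ℚ} (ht : 0 ≤ t) :
    0 < affineAction (freeToF2 (FreeSemigroup.of i)) t := by
  rw [freeToF2_of]
  fin_cases i
  · simp only [Fin.zero_eta, Matrix.cons_val_zero, affineAction_xg_apply]
    positivity
  · simp only [Fin.mk_one, Matrix.cons_val_one, Matrix.cons_val_zero, affineAction_yg_apply]
    positivity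
  · change 0 < affineAction (yg⁻¹ * yg⁻¹ * xg⁻¹ * yg) t
    simp only [map_mul, Equiv.Perm.mul_apply, affineAction_xg_inv_apply,
      affineAction_yg_inv_apply, affineAction_yg_apply]
    linarith

theorem affineAction_freeToF2_pos (w : FS3) {t : ℚ} (ht : 0 ≤ t) :
    0 < affineAction (freeToF2 w) t := by
  induction w using FreeSemigroup.recOnMul generalizing t with
  | ih1 i => exact affineAction_freeToF2_of_pos i ht
  | ih2 i w hi hw =>
    rw [map_mul, map_mul, Equiv.Perm.mul_apply]
    exact hi (hw ht).le

theorem freeToF2_ne_one (w : FS3) : freeToF2 w ≠ 1 := by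
  intro h
  simpa [h] using affineAction_freeToF2_pos w le_rfl

/-- The semigroup homomorphism `φ : A → F₂` determined by `a ↦ x`, `b ↦ y`,
`c ↦ y⁻²x⁻¹y` exists, and `φ w` is never the identity of `F₂`. -/
theorem stmt_15 : ∃ φ : A →ₙ* F2,
    φ aA = xg ∧ φ bA = yg ∧ φ cA = yg⁻¹ * yg⁻¹ * xg⁻¹ * yg ∧
    ∀ w : A, φ w ≠ 1 := by
  exact ⟨toF2, freeToF2_of 0, freeToF2_of 1, freeToF2_of 2,
    fun w => Con.induction_on w freeToF2_ne_one⟩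
end

section
/- The semigroup A defined by the presentation ⟨a, b, c | ab²c = b⟩ is monogenic subsemigroup separable but not weakly subsemigroup separable. -/
open FreeGroup in
/-- The finite-completion argument of M. Hall: a finite subset `V` of a set acted on by a free
group carries an action of the free group that agrees with the given one wherever a generator
does not leave `V`. -/
theorem FreeGroup.exists_hom_perm_extending {α X : Type*} [MulAction (FreeGroup α) X]
    (V : Finset X) :
    ∃ φ : FreeGroup α →* Equiv.Perm V,
      ∀ (a : α) (v : V), of a • (v : X) ∈ V → (φ (of a) v : X) = of a • (v : X) := by
  have key (a : α) : ∃ g : V ≃ V, ∀ v ∈ {v : V | of a • (v : X) ∈ V}, (g v : X) = of a • (v : X) :=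
    Set.MapsTo.exists_equiv_extend_of_card_eq (by simp) (fun _ hv => hv)
      (fun v _ w _ h => Subtype.ext (MulAction.injective (of a) h))
  choose g hg using key
  exact ⟨lift g, fun a v hv => by simpa using hg a v hv⟩

/-- Along a word all of whose suffixes keep the base point inside `V`, the completed action agrees
with the original one. -/
theorem FreeGroup.exists_hom_perm_agreeing {α X : Type*} [MulAction (FreeGroup α) X]
    (V : Finset X) (v₀ : V) :
    ∃ φ : FreeGroup α →* Equiv.Perm V, ∀ L : List (α × Bool),
      (∀ t, t <:+ L → mk t • (v₀ : X) ∈ V) → (φ (mk L) v₀ : X) = mk L • (v₀ : X) := by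
  obtain ⟨φ, hφ⟩ := exists_hom_perm_extending (α := α) V
  refine ⟨φ, fun L => ?_⟩
  induction L with
  | nil => intro _; simp [← one_eq_mk]
  | cons x L ih =>
    intro h
    have ih := ih fun t ht => h t (ht.trans (List.suffix_cons x L))
    have hx := h _ List.suffix_rfl
    obtain ⟨a, _ | _⟩ := x
    · have e : mk ((a, false) :: L) = (of a)⁻¹ * mk L := by simp [of, invRev]
      rw [e, mul_smul, ← ih] at hx ⊢
      have := hφ a ⟨_, hx⟩ (by rw [smul_inv_smul]; exact (φ (mk L) v₀).2)
      rw [smul_inv_smul, SetCoe.ext_iff] at this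
      rw [_root_.map_mul, _root_.map_inv, Equiv.Perm.mul_apply, Equiv.Perm.inv_eq_iff_eq.2 this.symm]
    · have e : mk ((a, true) :: L) = of a * mk L := by simp [of]
      rw [e, mul_smul, ← ih] at hx ⊢
      rw [_root_.map_mul, Equiv.Perm.mul_apply, hφ a _ hx]

open FreeGroup in
/-- Cyclic subgroup separability of free groups. -/
theorem FreeGroup.exists_finite_perm_separating {α : Type} {g x : FreeGroup α}
    (hg : g ∉ Subgroup.zpowers x) :
    ∃ (V : Type) (_ : Finite V) (φ : FreeGroup α →* Equiv.Perm V) (v₀ : V),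
      φ x v₀ = v₀ ∧ φ g v₀ ≠ v₀ := by
  classical
  let X := FreeGroup α ⧸ Subgroup.zpowers x
  let o : X := ((1 : FreeGroup α) : X)
  let V : Finset X :=
    ((g.toWord.tails ++ x.toWord.tails).map fun t => mk t • o).toFinset
  have hV (t) (ht : t <:+ g.toWord ∨ t <:+ x.toWord) : mk t • o ∈ V := by
    simp only [V, List.mem_toFinset, List.mem_map, List.mem_append, List.mem_tails]
    exact ⟨t, ht, rfl⟩
  have ho : o ∈ V := by
    simpa [← one_eq_mk] using hV [] (Or.inl (List.nil_suffix))
  obtain ⟨φ, hφ⟩ := exists_hom_perm_agreeing (α := α) V ⟨o, ho⟩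
  have smul_o (h : FreeGroup α) : h • o = ((h : FreeGroup α) : X) := by
    change ((h * 1 : FreeGroup α) : X) = _
    rw [mul_one]
  have hx := hφ x.toWord fun t ht => hV t (Or.inr ht)
  have hgo := hφ g.toWord fun t ht => hV t (Or.inl ht)
  rw [mk_toWord, smul_o] at hx hgo
  refine ⟨V, inferInstance, φ, ⟨o, ho⟩, Subtype.ext ?_, fun h => hg ?_⟩
  · rw [hx]
    exact QuotientGroup.eq.2 (by simp)
  · rw [h] at hgo
    simpa using QuotientGroup.eq.1 hgo

/-- Words in the generators of `A` that contain no factor `ab²c`. -/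
def NormalWord : List (Fin 3) → Prop
  | [] => True
  | x :: w => ¬ [0, 1, 1, 2] <+: x :: w ∧ NormalWord w

theorem normalWord_of_two_notMem {w : List (Fin 3)} (h : 2 ∉ w) : NormalWord w := by
  induction w with
  | nil => trivial
  | cons x w ih =>
    exact ⟨fun hp => h (hp.subset (by simp)), ih fun hw => h (List.mem_cons_of_mem x hw)⟩

/-- In a monoid satisfying `ab²c = b`, every word has the same value as a normal one. -/
theorem exists_normalWord_prod_eq {M : Type*} [Monoid M] (g : Fin 3 → M)
    (hg : g 0 * (g 1 * (g 1 * g 2)) = g 1) (w : List (Fin 3)) :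
    ∃ n, NormalWord n ∧ (n.map g).prod = (w.map g).prod := by
  induction w with
  | nil => exact ⟨[], trivial, rfl⟩
  | cons x w ih =>
    obtain ⟨n, hn, e⟩ := ih
    by_cases hp : [0, 1, 1, 2] <+: x :: n
    · obtain ⟨r, hr⟩ := hp
      simp only [List.cons_append, List.nil_append, List.cons.injEq] at hr
      obtain ⟨rfl, rfl⟩ := hr
      refine ⟨1 :: r, ⟨by simp, hn.2.2.2⟩, ?_⟩
      rw [List.map_cons, List.map_cons, List.prod_cons, List.prod_cons, ← e]
      nth_rw 1 [← hg]
      simp [mul_assoc]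
    · exact ⟨x :: n, ⟨hp, hn⟩, by simp [e]⟩

/-- The images in `F₂` of the generators of `A`; they satisfy `ab = x` and `bc = y`. -/
def genF2 : Fin 3 → F2 := ![xg * yg⁻¹ * xg⁻¹, xg * yg, yg⁻¹ * xg⁻¹ * yg]

/-- The possible beginnings of the reduced word in `F₂` of the value of a normal word. -/
inductive Shape : List (Fin 3) → List (Fin 2 × Bool) → Prop
  | nil : Shape [] []
  | a_xY (w r) : Shape (0 :: w) ((0, true) :: (1, false) :: r)
  | a_xx (w r) : Shape (0 :: w) ((0, true) :: (0, true) :: r)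
  | a_x (w) : Shape (0 :: w) [(0, true)]
  | bbc (w r) : Shape (1 :: 1 :: 2 :: w) ((0, true) :: (1, true) :: r)
  | b_xy (w) : Shape (1 :: w) [(0, true), (1, true)]
  | b_xyx (w r) : Shape (1 :: w) ((0, true) :: (1, true) :: (0, true) :: r)
  | bc_X (w r) : Shape (1 :: 2 :: w) ((0, false) :: r)
  | bc_y (w r) : Shape (1 :: 2 :: w) ((1, true) :: r)
  | c_YXy (w r) : Shape (2 :: w) ((1, false) :: (0, false) :: (1, true) :: r)
  | c_YXX (w r) : Shape (2 :: w) ((1, false) :: (0, false) :: (0, false) :: r)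

theorem Shape.head?_eq {u v : List (Fin 3)} {L : List (Fin 2 × Bool)} (hu : Shape u L)
    (hv : Shape v L) : u.head? = v.head? := by
  cases hu <;> cases hv <;> rfl

theorem mk_x_cons (L : List (Fin 2 × Bool)) :
    FreeGroup.mk ((0, true) :: L) = xg * FreeGroup.mk L := by simp [xg, FreeGroup.of]

theorem mk_X_cons (L : List (Fin 2 × Bool)) :
    FreeGroup.mk ((0, false) :: L) = xg⁻¹ * FreeGroup.mk L := by
  simp [xg, FreeGroup.of, FreeGroup.invRev]

theorem mk_y_cons (L : List (Fin 2 × Bool)) :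
    FreeGroup.mk ((1, true) :: L) = yg * FreeGroup.mk L := by simp [yg, FreeGroup.of]

theorem mk_Y_cons (L : List (Fin 2 × Bool)) :
    FreeGroup.mk ((1, false) :: L) = yg⁻¹ * FreeGroup.mk L := by
  simp [yg, FreeGroup.of, FreeGroup.invRev]

open FreeGroup in
theorem Shape.exists_cons {x : Fin 3} {w : List (Fin 3)} {L : List (Fin 2 × Bool)}
    (hw : NormalWord (x :: w)) (hL : IsReduced L) (h : Shape w L) :
    ∃ L', IsReduced L' ∧ Shape (x :: w) L' ∧ mk L' = genF2 x * mk L := by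
  have hx : ∀ y : Fin 3, y = 0 ∨ y = 1 ∨ y = 2 := by decide
  rcases hx x with rfl | rfl | rfl
  · cases h
    case bbc => exact absurd hw.1 (by simp)
    case' nil => refine ⟨_, ?_, .a_xY _ [(0, false)], ?_⟩
    case' a_xY r => refine ⟨_, ?_, .a_xY _ ((1, false) :: r), ?_⟩
    case' a_xx r => refine ⟨_, ?_, .a_xY _ ((0, true) :: r), ?_⟩
    case' a_x => refine ⟨_, ?_, .a_xY _ [], ?_⟩
    case' b_xy => refine ⟨_, ?_, .a_x _, ?_⟩
    case' b_xyx r => refine ⟨_, ?_, .a_xx _ r, ?_⟩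
    case' bc_X r => refine ⟨_, ?_, .a_xY _ ((0, false) :: (0, false) :: r), ?_⟩
    case' bc_y r => refine ⟨_, ?_, .a_xY _ ((0, false) :: (1, true) :: r), ?_⟩
    case' c_YXy r =>
      refine ⟨_, ?_, .a_xY _ ((0, false) :: (1, false) :: (0, false) :: (1, true) :: r), ?_⟩
    case' c_YXX r =>
      refine ⟨_, ?_, .a_xY _ ((0, false) :: (1, false) :: (0, false) :: (0, false) :: r), ?_⟩
    all_goals simp_all [genF2, mk_x_cons, mk_X_cons, mk_y_cons, mk_Y_cons, ← one_eq_mk, mul_assoc]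
  · cases h
    case' nil => refine ⟨_, ?_, .b_xy _, ?_⟩
    case' a_xY r => refine ⟨_, ?_, .b_xyx _ ((1, false) :: r), ?_⟩
    case' a_xx r => refine ⟨_, ?_, .b_xyx _ ((0, true) :: r), ?_⟩
    case' a_x => refine ⟨_, ?_, .b_xyx _ [], ?_⟩
    case' bbc r => refine ⟨_, ?_, .b_xyx _ ((1, true) :: r), ?_⟩
    case' b_xy => refine ⟨_, ?_, .b_xyx _ [(1, true)], ?_⟩
    case' b_xyx r => refine ⟨_, ?_, .b_xyx _ ((1, true) :: (0, true) :: r), ?_⟩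
    case' bc_X r => refine ⟨_, ?_, .bbc _ ((0, false) :: r), ?_⟩
    case' bc_y r => refine ⟨_, ?_, .bbc _ ((1, true) :: r), ?_⟩
    case' c_YXy r => refine ⟨_, ?_, .bc_y _ r, ?_⟩
    case' c_YXX r => refine ⟨_, ?_, .bc_X _ r, ?_⟩
    all_goals simp_all [genF2, mk_x_cons, mk_X_cons, mk_y_cons, mk_Y_cons, ← one_eq_mk, mul_assoc]
  · generalize hM : L = M at h
    cases h
    case' c_YXy r => refine ⟨_, ?_, .c_YXX _ ((1, true) :: r), ?_⟩
    case' c_YXX r => refine ⟨_, ?_, .c_YXX _ ((0, false) :: r), ?_⟩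
    case' nil | a_xY | a_xx | a_x | bbc | b_xy | b_xyx | bc_X | bc_y =>
      refine ⟨_, ?_, .c_YXy _ L, ?_⟩
    all_goals simp_all [genF2, mk_x_cons, mk_X_cons, mk_y_cons, mk_Y_cons, ← one_eq_mk, mul_assoc]

open FreeGroup in
theorem NormalWord.exists_shape {w : List (Fin 3)} (hw : NormalWord w) :
    ∃ L, IsReduced L ∧ Shape w L ∧ mk L = (w.map genF2).prod := by
  induction w with
  | nil => exact ⟨[], .nil, .nil, rfl⟩
  | cons x w ih =>
    obtain ⟨L, hL, hs, e⟩ := ih hw.2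
    simpa [e] using hs.exists_cons hw hL

theorem NormalWord.head?_eq_of_prod_eq {u v : List (Fin 3)} (hu : NormalWord u)
    (hv : NormalWord v) (h : (u.map genF2).prod = (v.map genF2).prod) : u.head? = v.head? := by
  obtain ⟨L, hL, hs, e⟩ := hu.exists_shape
  obtain ⟨L', hL₂, hs₂, e₂⟩ := hv.exists_shape
  have : L = L' := by
    rw [← hL.reduce_eq, ← hL₂.reduce_eq, ← FreeGroup.toWord_mk, ← FreeGroup.toWord_mk, e, e₂, h]
  exact hs.head?_eq (this ▸ hs₂)

/-- Distinct normal words have distinct values in `F₂`. -/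
theorem NormalWord.eq_of_prod_eq {u v : List (Fin 3)} (hu : NormalWord u) (hv : NormalWord v)
    (h : (u.map genF2).prod = (v.map genF2).prod) : u = v := by
  have hh := hu.head?_eq_of_prod_eq hv h
  induction u generalizing v with
  | nil => cases v <;> simp_all
  | cons x u ih =>
    cases v with
    | nil => simp at hh
    | cons y v =>
      obtain rfl : x = y := by simpa using hh
      have htail : (u.map genF2).prod = (v.map genF2).prod := by simpa using h
      rw [ih hu.2 hv.2 htail (hu.2.head?_eq_of_prod_eq hv.2 htail)]

/-- The generators of `A`. -/
def genA : Fin 3 → A := fun i => ((FreeSemigroup.of i : FS3) : A)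

theorem relation_A : aA * bA * bA * cA = bA :=
  (Con.eq conA).2 (ConGen.Rel.of _ _ ⟨rfl, rfl⟩)

/-- The value of a word in `A` with an identity adjoined. -/
def evalA (w : List (Fin 3)) : WithOne A := (w.map fun i => (genA i : WithOne A)).prod

theorem evalA_append (u v : List (Fin 3)) : evalA (u ++ v) = evalA u * evalA v := by
  simp [evalA]

theorem exists_normalWord_evalA (s : A) : ∃ w, NormalWord w ∧ evalA w = s := by
  have hs : ∃ w, evalA w = s := by
    induction s using Con.induction_on with
    | H u =>
      induction u using FreeSemigroup.recOnMul with
      | ih1 i => exact ⟨[i], by simp [evalA, genA]⟩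
      | ih2 i u hi hu =>
        obtain ⟨v, hv⟩ := hi
        obtain ⟨w, hw⟩ := hu
        exact ⟨v ++ w, by rw [evalA_append, hv, hw, Con.coe_mul, WithOne.coe_mul]⟩
  obtain ⟨w, hw⟩ := hs
  obtain ⟨n, hn, e⟩ := exists_normalWord_prod_eq (fun i => (genA i : WithOne A))
    (by
      simp only [← WithOne.coe_mul, ← mul_assoc]
      exact congrArg WithOne.coe relation_A) w
  exact ⟨n, hn, e.trans hw⟩

/-- The homomorphism `A → F₂` with `ab ↦ x` and `bc ↦ y`. -/
def homF2 : A →ₙ* F2 where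
  toFun s := Con.liftOn s (FreeSemigroup.lift genF2) fun u v h => by
    have : conA ≤ Con.ker (FreeSemigroup.lift genF2) := by
      refine Con.conGen_le.2 ?_
      rintro u v ⟨rfl, rfl⟩
      simp [genF2, mul_assoc]
    exact this h
  map_mul' s t := by
    induction s, t using Con.induction_on₂ with
    | H u v => exact map_mul (FreeSemigroup.lift genF2) u v

theorem lift_homF2_evalA (w : List (Fin 3)) :
    WithOne.lift homF2 (evalA w) = (w.map genF2).prod := by
  rw [evalA, map_list_prod, List.map_map]
  rfl

/-- `A` with an identity adjoined embeds in `F₂`. -/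
theorem lift_homF2_injective : Function.Injective (WithOne.lift homF2) := by
  have h (s : WithOne A) : ∃ w, NormalWord w ∧ evalA w = s := by
    induction s using WithOne.recOneCoe with
    | one => exact ⟨[], trivial, rfl⟩
    | coe s => exact exists_normalWord_evalA s
  intro s t e
  obtain ⟨u, hu, rfl⟩ := h s
  obtain ⟨v, hv, rfl⟩ := h t
  rw [lift_homF2_evalA, lift_homF2_evalA] at e
  rw [hu.eq_of_prod_eq hv e]

theorem evalA_eq_iff {u v : List (Fin 3)} (hu : NormalWord u) (hv : NormalWord v) :
    evalA u = evalA v ↔ u = v := by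
  refine ⟨fun h => hu.eq_of_prod_eq hv ?_, fun h => h ▸ rfl⟩
  rw [← lift_homF2_evalA, h, lift_homF2_evalA]

theorem WithOne.exists_mem_closure_pow {S : Type*} [Semigroup S] (x : S) (n : ℕ) :
    ∃ y ∈ Subsemigroup.closure {x}, (y : WithOne S) = x ^ (n + 1) := by
  induction n with
  | zero => exact ⟨x, Subsemigroup.subset_closure rfl, by simp⟩
  | succ n ih =>
    obtain ⟨y, hy, e⟩ := ih
    exact ⟨y * x, mul_mem hy (Subsemigroup.subset_closure rfl), by
      rw [coe_mul, e, pow_succ _ (n + 1)]⟩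

theorem WithOne.coe_mul_pow_ne_one {S : Type*} [Semigroup S] (s x : S) (n : ℕ) :
    (s : WithOne S) * x ^ n ≠ 1 := by
  cases n with
  | zero => simp
  | succ n =>
    obtain ⟨y, -, e⟩ := exists_mem_closure_pow x n
    rw [← e, ← coe_mul]
    exact coe_ne_one

theorem homF2_notMem_zpowers {s x : A} (h : s ∉ Subsemigroup.closure {x}) :
    homF2 s ∉ Subgroup.zpowers (homF2 x) := by
  rintro ⟨k, hk⟩
  simp only at hk
  rcases k.eq_nat_or_neg with ⟨n, rfl | rfl⟩
  · cases n with
    | zero =>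
      refine WithOne.coe_mul_pow_ne_one s x 0 (lift_homF2_injective ?_)
      simpa using hk.symm
    | succ n =>
      obtain ⟨y, hy, e⟩ := WithOne.exists_mem_closure_pow x n
      have : (y : WithOne A) = s := lift_homF2_injective <| by
        rw [e, map_pow, WithOne.lift_coe, WithOne.lift_coe, ← hk, zpow_natCast]
      exact h (WithOne.coe_inj.1 this ▸ hy)
  · refine WithOne.coe_mul_pow_ne_one s x n (lift_homF2_injective ?_)
    simp [← hk]

theorem isMSS_A : IsMSS A := by
  intro s x h
  obtain ⟨V, _, φ, v₀, hx, hs⟩ :=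
    FreeGroup.exists_finite_perm_separating (homF2_notMem_zpowers h)
  refine ⟨Equiv.Perm V, inferInstance, inferInstance, (φ : F2 →ₙ* Equiv.Perm V).comp homF2, ?_⟩
  rintro ⟨y, hy, e⟩
  have fix : φ (homF2 y) v₀ = v₀ := by
    clear e
    induction hy using Subsemigroup.closure_induction with
    | mem z hz => rwa [Set.mem_singleton_iff.1 hz]
    | mul z w _ _ hz hw =>
      rw [map_mul, map_mul, Equiv.Perm.mul_apply, hw, hz]
  exact hs ((congrArg (fun σ : Equiv.Perm V => σ v₀) e).symm.trans fix)

/-- In a finite monoid with `abd = b`, also `aⁿb = b` for some `n ≥ 1`. -/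
theorem exists_pow_succ_mul_eq {M : Type*} [Monoid M] [Finite M] {a b d : M} (h : a * b * d = b) :
    ∃ n : ℕ, a ^ (n + 1) * b = b := by
  have key (n : ℕ) : a ^ n * b * d ^ n = b := by
    induction n with
    | zero => simp
    | succ n ih =>
      calc a ^ (n + 1) * b * d ^ (n + 1) = a ^ n * (a * b * d) * d ^ n := by
            simp only [pow_succ a, pow_succ' d, mul_assoc]
        _ = b := by rw [h, ih]
  obtain ⟨i, j, hij, e⟩ := Set.finite_univ.exists_lt_map_eq_of_forall_mem
    (f := fun n : ℕ => a ^ n) (fun _ => Set.mem_univ _)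
  obtain ⟨n, rfl⟩ := Nat.exists_eq_add_of_lt hij
  refine ⟨n, ?_⟩
  have e : a ^ i = a ^ (n + 1) * a ^ i := by
    rw [← pow_add, add_comm, ← add_assoc]; exact e
  calc a ^ (n + 1) * b = a ^ (n + 1) * a ^ i * b * d ^ i := by
        nth_rw 1 [← key i]; simp only [mul_assoc]
    _ = b := by rw [← e, key]

open scoped Classical in
theorem not_isWSS_A : ¬ IsWSS A := by
  intro h
  have hb : bA ∉ Subsemigroup.closure (({aA, aA * bA} : Finset A) : Set A) := by
    intro hb
    have key : ∀ y ∈ Subsemigroup.closure (({aA, aA * bA} : Finset A) : Set A),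
        ∃ w : List (Fin 3), 2 ∉ w ∧ evalA (0 :: w) = y := by
      intro y hy
      induction hy using Subsemigroup.closure_induction with
      | mem y hy =>
        simp only [Finset.coe_insert, Finset.coe_singleton, Set.mem_insert_iff,
          Set.mem_singleton_iff] at hy
        rcases hy with rfl | rfl
        · exact ⟨[], by simp, by simp [evalA]; rfl⟩
        · exact ⟨[1], by simp, by simp [evalA]; rfl⟩
      | mul y z _ _ hy hz =>
        obtain ⟨u, hu, e⟩ := hy
        obtain ⟨v, hv, e'⟩ := hz
        refine ⟨u ++ 0 :: v, by simp [hu, hv], ?_⟩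
        rw [← List.cons_append, evalA_append, e, e', WithOne.coe_mul]
    obtain ⟨w, hw, e⟩ := key bA hb
    have e' : evalA (0 :: w) = evalA [1] := by rw [e]; simp [evalA]; rfl
    rw [evalA_eq_iff (normalWord_of_two_notMem (by simpa using hw))
      (normalWord_of_two_notMem (by simp))] at e'
    simp at e'
  obtain ⟨P, _, _, φ, hφ⟩ := h bA _ hb
  have : Finite (WithOne P) := inferInstanceAs (Finite (Option P))
  let ψ := WithOne.mapMulHom φ
  obtain ⟨n, hn⟩ := exists_pow_succ_mul_eq (a := ψ aA) (b := ψ bA) (d := ψ (bA * cA)) (by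
    rw [← map_mul, ← map_mul, ← WithOne.coe_mul, ← WithOne.coe_mul, ← WithOne.coe_mul,
      ← mul_assoc, relation_A])
  have hpow (n : ℕ) : ∃ y ∈ Subsemigroup.closure (({aA, aA * bA} : Finset A) : Set A),
      (y : WithOne A) = (aA : WithOne A) ^ (n + 1) * bA := by
    induction n with
    | zero => exact ⟨aA * bA, Subsemigroup.subset_closure (by simp), by simp⟩
    | succ n ih =>
      obtain ⟨y, hy, e⟩ := ih
      exact ⟨aA * y, mul_mem (Subsemigroup.subset_closure (by simp)) hy, by
        rw [WithOne.coe_mul, e, ← mul_assoc, ← pow_succ']⟩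
  obtain ⟨y, hy, e⟩ := hpow n
  refine hφ ⟨y, hy, WithOne.coe_inj.1 ?_⟩
  rw [← map_pow, ← map_mul, ← e] at hn
  exact hn

/-- The semigroup `A = ⟨a,b,c ∣ ab²c = b⟩` is monogenic subsemigroup separable but
not weakly subsemigroup separable. -/
theorem stmt_16 : IsMSS A ∧ ¬ IsWSS A :=
  ⟨isMSS_A, not_isWSS_A⟩
end

section
/- Let S be a finite semigroup and let x ∈ S be such that x and x² generate the same two-sided ideal of S (i.e. S¹xS¹ = S¹x²S¹, where S¹xS¹ = {x} ∪ xS ∪ Sx ∪ SxS). Then x belongs to a subgroup of S, i.e. some subsemigroup of S containing x is a group. -/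
/-- The two-sided ideal `S¹xS¹ = {x} ∪ xS ∪ Sx ∪ SxS` generated by `x`. -/
def twoSidedIdeal {S : Type*} [Semigroup S] (x : S) : Set S :=
  {y | y = x ∨ (∃ s, y = x * s) ∨ (∃ s, y = s * x) ∨ ∃ s t, y = s * x * t}

/-- In a finite monoid, `x = c * x * b` forces some positive power of `c` to fix `x`
on the left. -/
theorem exists_pow_succ_mul_eq_of_mul_mul_eq {M : Type*} [Monoid M] [Finite M] {c x b : M}
    (h : c * x * b = x) : ∃ p : ℕ, c ^ (p + 1) * x = x := by
  have iter : ∀ n : ℕ, c ^ n * x * b ^ n = x := by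
    intro n
    induction n with
    | zero => simp
    | succ n ih =>
      calc c ^ (n + 1) * x * b ^ (n + 1) = c ^ n * (c * x * b) * b ^ n := by
            rw [pow_succ, pow_succ']; simp only [mul_assoc]
        _ = x := by rw [h, ih]
  obtain ⟨i, j, hij, heq⟩ : ∃ i j : ℕ, i < j ∧ c ^ i = c ^ j := by
    obtain ⟨i, j, hne, heq⟩ := Finite.exists_ne_map_eq_of_infinite (fun n : ℕ => c ^ n)
    rcases lt_or_gt_of_ne hne with hlt | hlt
    · exact ⟨i, j, hlt, heq⟩
    · exact ⟨j, i, hlt, heq.symm⟩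
  obtain ⟨p, rfl⟩ := Nat.exists_eq_add_of_lt hij
  refine ⟨p, ?_⟩
  calc c ^ (p + 1) * x = c ^ (p + 1) * (c ^ i * x * b ^ i) := by rw [iter]
    _ = c ^ (i + p + 1) * x * b ^ i := by
        rw [show i + p + 1 = p + 1 + i by omega, pow_add c (p + 1) i]; simp only [mul_assoc]
    _ = x := by rw [← heq, iter]

/-- In a finite monoid, `x = a * x² * b` forces `x` to be a proper power of itself. -/
theorem exists_mul_pow_succ_eq_self {M : Type*} [Monoid M] [Finite M] {a x b : M}
    (h : a * (x * x) * b = x) : ∃ p : ℕ, x * x ^ (p + 1) = x := by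
  obtain ⟨p, hp⟩ := exists_pow_succ_mul_eq_of_mul_mul_eq (c := a * x) (x := x) (b := b)
    (by simpa only [mul_assoc] using h)
  have hu : (a * x) ^ p * a * x * x = x := by
    rw [pow_succ] at hp
    simpa only [mul_assoc] using hp
  have : Finite Mᵐᵒᵖ := Finite.of_equiv M MulOpposite.opEquiv
  obtain ⟨q, hq⟩ := exists_pow_succ_mul_eq_of_mul_mul_eq (M := Mᵐᵒᵖ)
    (c := MulOpposite.op x) (x := MulOpposite.op x) (b := MulOpposite.op ((a * x) ^ p * a))
    (by simpa only [← MulOpposite.op_mul, MulOpposite.op_inj, mul_assoc] using hu)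
  refine ⟨q, ?_⟩
  simpa only [← MulOpposite.op_pow, ← MulOpposite.op_mul, MulOpposite.op_inj] using hq

/-- Positive powers, taken in `WithOne S`, of an element of `S` lie in `S`. -/
theorem WithOne.exists_coe_eq_pow_succ {S : Type*} [Semigroup S] (x : S) (k : ℕ) :
    ∃ s : S, (s : WithOne S) = (x : WithOne S) ^ (k + 1) := by
  induction k with
  | zero => exact ⟨x, by simp⟩
  | succ k ih =>
    obtain ⟨s, hs⟩ := ih
    exact ⟨s * x, by rw [WithOne.coe_mul, hs, pow_succ _ (k + 1)]⟩

/-- An element that is a proper power of itself belongs to a subgroup. -/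
theorem memSubgroup_of_mul_pow_succ_eq {S : Type*} [Semigroup S] {x : S} {p : ℕ}
    (h : (x : WithOne S) * (x : WithOne S) ^ (p + 1) = x) : MemSubgroup x := by
  have hidem : IsIdempotentElem ((x : WithOne S) ^ (p + 1)) := by
    change _ * _ = _
    nth_rw 1 [pow_succ]
    rw [mul_assoc, h, ← pow_succ]
  have hpow (k : ℕ) : (x : WithOne S) ^ (k + 1) * (x : WithOne S) ^ (p + 1) =
      (x : WithOne S) ^ (k + 1) := by
    rw [pow_succ _ k, mul_assoc, h]
  have hinv (k : ℕ) : (x : WithOne S) ^ ((k + 1) * (2 * p + 1)) * (x : WithOne S) ^ (k + 1) =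
      (x : WithOne S) ^ (p + 1) := by
    rw [← pow_add, show (k + 1) * (2 * p + 1) + (k + 1) = (p + 1) * (2 * k + 1 + 1) by ring,
      pow_mul, hidem.pow_succ_eq]
  refine ⟨{ carrier := {s | ∃ k : ℕ, (s : WithOne S) = (x : WithOne S) ^ (k + 1)}
            mul_mem' := ?_ }, ⟨0, by simp⟩, ?_⟩
  · rintro a b ⟨k, hk⟩ ⟨l, hl⟩
    exact ⟨k + l + 1, by rw [WithOne.coe_mul, hk, hl, ← pow_add]; congr 1; omega⟩
  obtain ⟨e, he⟩ := WithOne.exists_coe_eq_pow_succ x p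
  refine ⟨e, ⟨p, he⟩, ?_, ?_⟩
  · rintro s ⟨k, hk⟩
    constructor <;> apply WithOne.coe_injective <;> rw [WithOne.coe_mul, he, hk]
    · rw [← pow_mul_comm, hpow]
    · exact hpow k
  · rintro s ⟨k, hk⟩
    have hm : (k + 1) * (2 * p + 1) = 2 * k * p + 2 * p + k + 1 := by ring
    obtain ⟨t, ht⟩ := WithOne.exists_coe_eq_pow_succ x (2 * k * p + 2 * p + k)
    rw [← hm] at ht
    refine ⟨t, ⟨_, hm ▸ ht⟩, ?_, ?_⟩ <;> apply WithOne.coe_injective <;>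
      rw [WithOne.coe_mul, he, hk, ht]
    · rw [← pow_mul_comm, hinv]
    · exact hinv k

/-- Membership in the two-sided ideal generated by `x`, expressed in `WithOne S`. -/
theorem exists_mul_mul_eq_of_mem_twoSidedIdeal {S : Type*} [Semigroup S] {x y : S}
    (h : y ∈ twoSidedIdeal x) : ∃ a b : WithOne S, a * (x : WithOne S) * b = y := by
  rcases h with rfl | ⟨s, rfl⟩ | ⟨s, rfl⟩ | ⟨s, t, rfl⟩
  · exact ⟨1, 1, by simp⟩
  · exact ⟨1, s, by simp⟩
  · exact ⟨s, 1, by simp⟩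
  · exact ⟨s, t, by simp⟩

/-- In a finite semigroup, if `x` and `x²` generate the same two-sided ideal then
`x` belongs to a subgroup. -/
theorem stmt_17 (S : Type*) [Semigroup S] [Finite S] (x : S)
    (h : twoSidedIdeal x = twoSidedIdeal (x * x)) : MemSubgroup x := by
  have : Finite (WithOne S) := inferInstanceAs (Finite (Option S))
  have hx : x ∈ twoSidedIdeal (x * x) := h ▸ Or.inl rfl
  obtain ⟨a, b, hab⟩ := exists_mul_mul_eq_of_mem_twoSidedIdeal hx
  rw [WithOne.coe_mul] at hab
  obtain ⟨p, hp⟩ := exists_mul_pow_succ_eq_self hab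
  exact memSubgroup_of_mul_pow_succ_eq hp
end
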